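/- Let (W,S) be an irreducible, 2-spherical Coxeter system with W infinite (the rank may be infinite). Then W is reflection independent: for every Coxeter system (W',S') and every group isomorphism f : W → W', one has f(S^W) = S'^{W'}, i.e., f maps the reflections of (W,S) exactly onto the reflections of (W',S'). -/

import Mathlib

namespace CoxRefl

open CoxeterSystem

variable {B W : Type*} [Group W] {M : CoxeterMatrix B}

/-- The simple root attached to `i`. -/
noncomputable def al (i : B) : B →₀ ℝ := Finsupp.single i 1

/-- The canonical bilinear form of the geometric representation. -/
noncomputable def bf (M : CoxeterMatrix B) : (B →₀ ℝ) →ₗ[ℝ] (B →₀ ℝ) →ₗ[ℝ] ℝ :=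
  Finsupp.linearCombination ℝ
    (fun i => Finsupp.linearCombination ℝ (fun j => - Real.cos (Real.pi / M i j)))

theorem bf_al (i j : B) : bf M (al i) (al j) = - Real.cos (Real.pi / M i j) := by
  simp [bf, al]

theorem al_apply_self (i : B) : (al i : B →₀ ℝ) i = 1 := by simp [al]

theorem al_apply_ne {i j : B} (h : i ≠ j) : (al i : B →₀ ℝ) j = 0 := by simp [al, h]

theorem bf_symm (u v : B →₀ ℝ) : bf M u v = bf M v u := by
  have : bf M = (bf M).flip := by
    apply Finsupp.lhom_ext'
    intro i
    ext j
    have h1 := bf_al (M := M) i j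
    have h2 := bf_al (M := M) j i
    rw [M.symmetric i j] at h1
    simp only [al] at h1 h2
    simp [h1, h2]
  conv_lhs => rw [this]
  rfl

theorem bf_al_self (i : B) : bf M (al i) (al i) = 1 := by
  simp [bf_al]

/-- expansion of the form against a simple root -/
theorem bf_al_right (v : B →₀ ℝ) (j : B) :
    bf M v (al j) = v.sum fun i a => a * bf M (al i) (al j) := by
  conv_lhs => rw [← Finsupp.sum_single v]
  rw [Finsupp.sum, map_sum, LinearMap.sum_apply]
  apply Finset.sum_congr rfl
  intro i _
  have : Finsupp.single i (v i) = (v i) • (al i : B →₀ ℝ) := by simp [al]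
  rw [this]
  simp

theorem bf_al_nonpos {i j : B} (h : i ≠ j) : bf M (al i) (al j) ≤ 0 := by
  rw [bf_al]
  have h1 : M i j ≠ 1 := M.off_diagonal i j h
  have : 0 ≤ Real.cos (Real.pi / M i j) := by
    rcases Nat.eq_zero_or_pos (M i j) with h0 | h0
    · simp [h0]
    · have h2 : (2 : ℝ) ≤ M i j := by exact_mod_cast (by omega : 2 ≤ M i j)
      apply Real.cos_nonneg_of_mem_Icc
      constructor
      · have : 0 ≤ Real.pi / M i j := by positivity
        linarith [Real.pi_pos]
      · apply div_le_div_of_nonneg_left Real.pi_pos.le (by norm_num) h2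
  linarith

theorem bf_al_le_of_ge {i j : B} {n : ℕ} (hn : 2 ≤ n) (h0 : n ≤ M i j) :
    bf M (al i) (al j) ≤ - Real.cos (Real.pi / n) := by
  rw [bf_al]
  have hn' : (2 : ℝ) ≤ n := by exact_mod_cast hn
  have h2 : (n : ℝ) ≤ M i j := by exact_mod_cast h0
  have : Real.cos (Real.pi / n) ≤ Real.cos (Real.pi / M i j) := by
    apply Real.cos_le_cos_of_nonneg_of_le_pi
    · positivity
    · exact div_le_self Real.pi_pos.le (by linarith)
    · exact div_le_div_of_nonneg_left Real.pi_pos.le (by linarith) h2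
  linarith

/-- Reflection in a vector. -/
noncomputable def sg (M : CoxeterMatrix B) (b : B →₀ ℝ) : Module.End ℝ (B →₀ ℝ) :=
  LinearMap.id - (2 : ℝ) • (bf M b).smulRight b

theorem sg_apply (b v : B →₀ ℝ) : sg M b v = v - (2 * bf M b v) • b := by
  simp [sg, smul_smul]

theorem sg_sg {b : B →₀ ℝ} (hb : bf M b b = 1) (v : B →₀ ℝ) : sg M b (sg M b v) = v := by
  simp only [sg_apply, map_sub, map_smul, hb, smul_eq_mul]
  module

theorem bf_sg {b : B →₀ ℝ} (hb : bf M b b = 1) (u v : B →₀ ℝ) :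
    bf M (sg M b u) (sg M b v) = bf M u v := by
  simp only [sg_apply, map_sub, map_smul, hb, smul_eq_mul, LinearMap.sub_apply,
    LinearMap.smul_apply, bf_symm u b]
  ring

/-- The Chebyshev type sequence `sin (n θ) / sin θ`. -/
noncomputable def ps (c : ℝ) : ℕ → ℝ
  | 0 => 0
  | 1 => 1
  | (n + 2) => 2 * c * ps c (n + 1) - ps c n

theorem ps_sin (θ : ℝ) (n : ℕ) : ps (Real.cos θ) n * Real.sin θ = Real.sin (n * θ) := by
  induction n using Nat.twoStepInduction with
  | zero => simp [ps]
  | one => simp [ps]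
  | more n h1 h2 =>
    have e1 : ((n + 2 : ℕ) : ℝ) * θ = ((n + 1 : ℕ) : ℝ) * θ + θ := by push_cast; ring
    have e2 : (n : ℝ) * θ = ((n + 1 : ℕ) : ℝ) * θ - θ := by push_cast; ring
    rw [e2, Real.sin_sub] at h1
    rw [e1, Real.sin_add, ps]
    have : Real.cos θ * Real.sin θ = Real.sin θ * Real.cos θ := by ring
    linear_combination 2 * Real.cos θ * h2 - h1

theorem ps_one (n : ℕ) : ps 1 n = n := by
  induction n using Nat.twoStepInduction with
  | zero => simp [ps]
  | one => simp [ps]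
  | more n h1 h2 => rw [ps, h1, h2]; push_cast; ring

/-- cosine of the angle -/
noncomputable def cc (M : CoxeterMatrix B) (i j : B) : ℝ := Real.cos (Real.pi / M i j)

theorem bf_cc (i j : B) : bf M (al i) (al j) = - cc M i j := bf_al i j

theorem cc_symm (i j : B) : cc M i j = cc M j i := by simp [cc, M.symmetric i j]

theorem sin_pos_M {i j : B} (h : i ≠ j) (h0 : M i j ≠ 0) : 0 < Real.sin (Real.pi / M i j) := by
  have h1 : M i j ≠ 1 := M.off_diagonal i j h
  have h2 : (2 : ℝ) ≤ M i j := by exact_mod_cast (by omega : 2 ≤ M i j)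
  apply Real.sin_pos_of_pos_of_lt_pi
  · have := Real.pi_pos; positivity
  · exact div_lt_self Real.pi_pos (by linarith)

theorem ps_nonneg {i j : B} (h : i ≠ j) {n : ℕ} (hn : M i j = 0 ∨ n ≤ M i j) :
    0 ≤ ps (cc M i j) n := by
  rcases Nat.eq_zero_or_pos (M i j) with h0 | h0
  · simp [cc, h0, ps_one]
  · have hn : n ≤ M i j := by omega
    have hs := sin_pos_M h h0.ne'
    have h1 := ps_sin (Real.pi / M i j) n
    have h2 : (n : ℝ) ≤ M i j := by exact_mod_cast hn
    have hp : (0 : ℝ) < M i j := by exact_mod_cast h0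
    have : 0 ≤ Real.sin (n * (Real.pi / M i j)) := by
      apply Real.sin_nonneg_of_nonneg_of_le_pi
      · have := Real.pi_pos; positivity
      · rw [← mul_div_assoc, div_le_iff₀ hp, mul_comm]
        exact mul_le_mul_of_nonneg_left h2 Real.pi_pos.le
    rw [← h1] at this
    exact nonneg_of_mul_nonneg_left this hs

theorem ps_M {i j : B} (h : i ≠ j) (h0 : M i j ≠ 0) : ps (cc M i j) (M i j) = 0 := by
  have hs := sin_pos_M h h0
  have h1 := ps_sin (Real.pi / M i j) (M i j)
  have hp : (M i j : ℝ) ≠ 0 := by exact_mod_cast h0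
  rw [mul_div_cancel₀ _ hp, Real.sin_pi] at h1
  exact (mul_eq_zero.1 h1).resolve_right hs.ne'

theorem ps_M_succ {i j : B} (h : i ≠ j) (h0 : M i j ≠ 0) : ps (cc M i j) (M i j + 1) = -1 := by
  have hs := sin_pos_M h h0
  have h1 := ps_sin (Real.pi / M i j) (M i j + 1)
  have hp : (M i j : ℝ) ≠ 0 := by exact_mod_cast h0
  have : ((M i j + 1 : ℕ) : ℝ) * (Real.pi / M i j) = Real.pi / M i j + Real.pi := by
    push_cast; field_simp; ring
  rw [this, Real.sin_add_pi] at h1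
  have : (ps (cc M i j) (M i j + 1) + 1) * Real.sin (Real.pi / M i j) = 0 := by
    rw [cc]; linarith
  have := (mul_eq_zero.1 this).resolve_right hs.ne'
  linarith

theorem ps_add_M {i j : B} (h : i ≠ j) (h0 : M i j ≠ 0) (n : ℕ) :
    ps (cc M i j) (M i j + n) = - ps (cc M i j) n := by
  induction n using Nat.twoStepInduction with
  | zero => simp [ps_M h h0, ps]
  | one => simp [ps_M_succ h h0, ps]
  | more n h1 h2 => rw [← add_assoc, ps, ps, add_assoc, h1, h2]; ring

theorem sg_pow_al (i j : B) (k : ℕ) :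
    ((sg M (al i) * sg M (al j)) ^ k) (al i) =
      ps (cc M i j) (2 * k + 1) • al i + ps (cc M i j) (2 * k) • al j ∧
    ((sg M (al i) * sg M (al j)) ^ k) (al j) =
      - ps (cc M i j) (2 * k) • al i -
        (2 * cc M i j * ps (cc M i j) (2 * k) - ps (cc M i j) (2 * k + 1)) • al j := by
  induction k with
  | zero => simp [ps]
  | succ k ih =>
    obtain ⟨h1, h2⟩ := ih
    have e1 : ps (cc M i j) (2 * (k + 1) + 1) =
      2 * cc M i j * ps (cc M i j) (2 * (k + 1)) - ps (cc M i j) (2 * k + 1) := rfl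
    have e2 : ps (cc M i j) (2 * (k + 1)) =
      2 * cc M i j * ps (cc M i j) (2 * k + 1) - ps (cc M i j) (2 * k) := rfl
    constructor <;>
    · simp only [pow_succ', Module.End.mul_apply, h1, h2, e1, e2]
      simp only [sg_apply, map_add, map_sub, map_smul, map_neg, bf_al_self, bf_cc, cc_symm j i, smul_eq_mul]
      module

theorem sg_fix {b v : B →₀ ℝ} (h : bf M b v = 0) : sg M b v = v := by simp [sg_apply, h]

/-- decomposition with respect to the plane of two simple roots -/
theorem plane_decomp {i j : B} (h : i ≠ j) (h0 : M i j ≠ 0) (v : B →₀ ℝ) :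
    ∃ a b : ℝ, ∃ v0, v = v0 + a • al i + b • al j ∧ bf M (al i) v0 = 0 ∧ bf M (al j) v0 = 0 := by
  have hs := sin_pos_M h h0
  set c := cc M i j with hc
  have hc2 : 1 - c ^ 2 ≠ 0 := by
    have := Real.sin_sq_add_cos_sq (Real.pi / M i j)
    have : 1 - c ^ 2 = Real.sin (Real.pi / M i j) ^ 2 := by rw [hc, cc]; linarith
    rw [this]; positivity
  set x := bf M (al i) v with hx
  set y := bf M (al j) v with hy
  refine ⟨(x + c * y) / (1 - c ^ 2), (y + c * x) / (1 - c ^ 2),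
    v - ((x + c * y) / (1 - c ^ 2)) • al i - ((y + c * x) / (1 - c ^ 2)) • al j, ?_, ?_, ?_⟩
  · module
  · simp only [map_sub, map_smul, bf_al_self, bf_cc, smul_eq_mul, ← hx, ← hc]
    field_simp; ring
  · simp only [map_sub, map_smul, bf_al_self, bf_cc, smul_eq_mul, ← hy, cc_symm j i, ← hc]
    field_simp; ring

theorem pow_fix {f : Module.End ℝ (B →₀ ℝ)} {v : B →₀ ℝ} (h : f v = v) (k : ℕ) : (f ^ k) v = v := by
  induction k with
  | zero => simp
  | succ k ih => rw [pow_succ', Module.End.mul_apply, ih, h]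

theorem liftable (M : CoxeterMatrix B) : M.IsLiftable (fun i => sg M (al i)) := by
  intro i j
  by_cases h : i = j
  · subst h
    ext1 v
    simp only [CoxeterMatrix.diagonal, pow_one, Module.End.mul_apply, Module.End.one_apply]
    ext1
    simp [sg_sg (bf_al_self i)]
  by_cases h0 : M i j = 0
  · simp [h0]
  apply LinearMap.ext
  intro v
  obtain ⟨a, b, v0, hv, h1, h2⟩ := plane_decomp h h0 v
  have hf : ((sg M (al i) * sg M (al j)) ^ M i j) v0 = v0 := by
    apply pow_fix
    rw [Module.End.mul_apply, sg_fix h2, sg_fix h1]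
  obtain ⟨e1, e2⟩ := sg_pow_al (M := M) i j (M i j)
  have p1 : ps (cc M i j) (2 * M i j) = 0 := by
    rw [two_mul, ps_add_M h h0, ps_M h h0, neg_zero]
  have p2 : ps (cc M i j) (2 * M i j + 1) = 1 := by
    rw [two_mul, add_assoc, ps_add_M h h0, ps_M_succ h h0, neg_neg]
  rw [p1, p2] at e1 e2
  rw [hv]
  simp only [map_add, map_smul, e1, e2, hf, Module.End.one_apply]
  module

/-- The geometric representation. -/
noncomputable def rho (cs : CoxeterSystem M W) : W →* Module.End ℝ (B →₀ ℝ) :=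
  cs.lift ⟨_, liftable M⟩

variable (cs : CoxeterSystem M W)

theorem rho_simple (i : B) : rho cs (cs.simple i) = sg M (al i) :=
  cs.lift_apply_simple (liftable M) i

theorem rho_mul (w w' : W) (v : B →₀ ℝ) : rho cs (w * w') v = rho cs w (rho cs w' v) := by
  simp

theorem rho_one (v : B →₀ ℝ) : rho cs 1 v = v := by simp

theorem rho_inv_rho (w : W) (v : B →₀ ℝ) : rho cs w⁻¹ (rho cs w v) = v := by
  rw [← rho_mul]; simp

theorem rho_rho_inv (w : W) (v : B →₀ ℝ) : rho cs w (rho cs w⁻¹ v) = v := by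
  rw [← rho_mul]; simp

theorem rho_inj (w : W) {u v : B →₀ ℝ} (h : rho cs w u = rho cs w v) : u = v := by
  rw [← rho_inv_rho cs w u, h, rho_inv_rho]

theorem bf_rho (w : W) (u v : B →₀ ℝ) : bf M (rho cs w u) (rho cs w v) = bf M u v := by
  induction w using cs.simple_induction_left generalizing u v with
  | one => simp
  | mul_simple_left w i ih => rw [rho_mul, rho_mul, rho_simple, bf_sg (bf_al_self i), ih]

theorem bf_rho_left (w : W) (u v : B →₀ ℝ) : bf M (rho cs w u) v = bf M u (rho cs w⁻¹ v) := by
  rw [← bf_rho cs w u, rho_rho_inv]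

theorem rho_simple_self (i : B) : rho cs (cs.simple i) (al i) = - al i := by
  rw [rho_simple, sg_apply, bf_al_self]; module

/-- action of alternating words -/
theorem rho_alt (i j : B) (k : ℕ) :
    rho cs (cs.wordProd (alternatingWord i j k)) (al i) =
      if Even k then ps (cc M i j) (k + 1) • al i + ps (cc M i j) k • al j
      else ps (cc M i j) (k + 1) • al j + ps (cc M i j) k • al i := by
  induction k with
  | zero => simp [alternatingWord, ps]
  | succ k ih =>
    rw [alternatingWord_succ', wordProd_cons, rho_mul, ih]
    have e1 : ps (cc M i j) (k + 1 + 1) =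
      2 * cc M i j * ps (cc M i j) (k + 1) - ps (cc M i j) k := rfl
    by_cases hk : Even k
    · have : ¬ Even (k + 1) := by simpa [Nat.even_add_one] using hk
      simp only [hk, this, if_true, if_false, rho_simple, e1]
      simp only [sg_apply, map_add, map_smul, bf_al_self, bf_cc, cc_symm j i, smul_eq_mul]
      module
    · have : Even (k + 1) := by simpa [Nat.even_add_one] using hk
      simp only [hk, this, if_true, if_false, rho_simple, e1]
      simp only [sg_apply, map_add, map_smul, bf_al_self, bf_cc, cc_symm j i, smul_eq_mul]
      module

end CoxRefl

namespace CoxRefl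

open CoxeterSystem

variable {B W : Type*} [Group W] {M : CoxeterMatrix B} (cs : CoxeterSystem M W)

theorem smul_nn {c : ℝ} (hc : 0 ≤ c) {v : B →₀ ℝ} (hv : 0 ≤ v) : 0 ≤ c • v := by
  intro x
  have := hv x
  simp only [Finsupp.coe_zero, Pi.zero_apply, Finsupp.coe_smul, Pi.smul_apply, smul_eq_mul] at *
  positivity

theorem al_nonneg (i : B) : (0 : B →₀ ℝ) ≤ al i := by
  simp [al]

theorem al_ne_zero (i : B) : (al i : B →₀ ℝ) ≠ 0 := by
  simp [al]

/-- `w` ends with the alternating word of length `k`, with no loss of length. -/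
def EndsAlt (i j : B) (w : W) (k : ℕ) : Prop :=
  ∃ v, w = v * cs.wordProd (alternatingWord i j k) ∧ cs.length w = cs.length v + k

theorem length_alt_le (i j : B) (k : ℕ) : cs.length (cs.wordProd (alternatingWord i j k)) ≤ k := by
  have := cs.length_wordProd_le (alternatingWord i j k)
  simpa using this

theorem endsAlt_down {i j : B} {w : W} {k : ℕ} (h : EndsAlt cs i j w (k + 1)) : EndsAlt cs i j w k := by
  obtain ⟨v, h1, h2⟩ := h
  rw [alternatingWord_succ', wordProd_cons, ← mul_assoc] at h1
  refine ⟨_, h1, ?_⟩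
  have a1 := cs.length_mul_le (v * cs.simple (if Even k then j else i)) (cs.wordProd (alternatingWord i j k))
  have a2 := length_alt_le cs i j k
  have a3 := cs.length_mul_simple v (if Even k then j else i)
  rw [← h1] at a1
  omega

theorem endsAlt_of_le {i j : B} {w : W} {k l : ℕ} (h : EndsAlt cs i j w k) (hl : l ≤ k) :
    EndsAlt cs i j w l := by
  induction k, hl using Nat.le_induction with
  | base => exact h
  | succ k _ ih => exact ih (endsAlt_down cs h)

theorem rho_nonneg (w : W) (i : B) (h : cs.length w < cs.length (w * cs.simple i)) :
    0 ≤ rho cs w (al i) := by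
  induction hn : cs.length w using Nat.strong_induction_on generalizing w i with
  | _ n IH =>
  by_cases hw : w = 1
  · subst hw; simpa using al_nonneg i
  obtain ⟨j, hj⟩ := cs.exists_rightDescent_of_ne_one hw
  unfold IsRightDescent at hj
  have hij : i ≠ j := by rintro rfl; omega
  classical
  have hP1 : EndsAlt cs i j w 1 := by
    refine ⟨w * cs.simple j, by simp [alternatingWord], ?_⟩
    have := cs.length_mul_simple w j
    omega
  have hb : 1 ≤ cs.length w := by omega
  set k := Nat.findGreatest (EndsAlt cs i j w) (cs.length w) with hk
  have hPk : EndsAlt cs i j w k := Nat.findGreatest_spec hb hP1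
  have hk1 : 1 ≤ k := Nat.le_findGreatest hb hP1
  have hPk1 : ¬ EndsAlt cs i j w (k + 1) := by
    intro h'
    have : k + 1 ≤ cs.length w := by obtain ⟨v, _, h2⟩ := h'; omega
    have := Nat.le_findGreatest this h'
    omega
  obtain ⟨v, hv, hl⟩ := hPk
  have hx : cs.length v < cs.length (v * cs.simple (if Even k then j else i)) := by
    by_contra hcon
    apply hPk1
    refine ⟨v * cs.simple (if Even k then j else i), ?_, ?_⟩
    · rw [alternatingWord_succ', wordProd_cons, ← mul_assoc, mul_assoc v]; simp [hv]
    · have := cs.length_mul_simple v (if Even k then j else i)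
      omega
  have hy : cs.length v < cs.length (v * cs.simple (if Even k then i else j)) := by
    by_contra hcon
    obtain ⟨k', hk'⟩ : ∃ k', k = k' + 1 := ⟨k - 1, by omega⟩
    have h3 := hv
    rw [hk', alternatingWord_succ', wordProd_cons, ← mul_assoc] at h3
    have : (if Even k' then j else i) = (if Even k then i else j) := by
      rw [hk']; by_cases hh : Even k' <;> simp [Nat.even_add_one, hh]
    rw [this] at h3
    have a1 := cs.length_mul_le (v * cs.simple (if Even k then i else j)) (cs.wordProd (alternatingWord i j k'))
    have a2 := length_alt_le cs i j k'
    have a3 := cs.length_mul_simple v (if Even k then i else j)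
    rw [← h3] at a1
    omega
  have hvi : 0 ≤ rho cs v (al i) := by
    apply IH (cs.length v) (by omega) v i _ rfl
    split_ifs at hx hy <;> assumption
  have hvj : 0 ≤ rho cs v (al j) := by
    apply IH (cs.length v) (by omega) v j _ rfl
    split_ifs at hx hy <;> assumption
  have hkM : M i j = 0 ∨ k + 1 ≤ M i j := by
    by_contra! hcon
    obtain ⟨h0, hM⟩ := hcon
    obtain ⟨v', h1, h2⟩ := endsAlt_of_le cs (l := M i j) ⟨v, hv, hl⟩ (by omega)
    obtain ⟨m, hm⟩ : ∃ m, M i j = m + 1 := ⟨M i j - 1, by omega⟩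
    have h3 := cs.prod_alternatingWord_eq_prod_alternatingWord_sub i j (M i j) (by omega)
    have h4 : M i j * 2 - M i j = m + 1 := by omega
    rw [h4, alternatingWord_succ, List.concat_eq_append, wordProd_append] at h3
    rw [h3, ← mul_assoc] at h1
    have h5 : w * cs.simple i = v' * cs.wordProd (alternatingWord i j m) := by
      rw [h1]; simp [mul_assoc]
    have a1 := cs.length_mul_le v' (cs.wordProd (alternatingWord i j m))
    have a2 := length_alt_le cs i j m
    rw [← h5] at a1
    omega
  have p1 : 0 ≤ ps (cc M i j) (k + 1) := ps_nonneg hij hkM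
  have p2 : 0 ≤ ps (cc M i j) k := ps_nonneg hij (by omega)
  rw [hv, rho_mul, rho_alt]
  split_ifs <;> simp only [map_add, map_smul] <;>
    exact add_nonneg (smul_nn p1 ‹_›) (smul_nn p2 ‹_›)

theorem rho_nonpos (w : W) (i : B) (h : cs.length (w * cs.simple i) < cs.length w) :
    rho cs w (al i) ≤ 0 := by
  have := rho_nonneg cs (w * cs.simple i) i (by simpa using h)
  rw [rho_mul, rho_simple_self, map_neg] at this
  simpa using this

theorem rho_eq_zero_iff (w : W) (v : B →₀ ℝ) : rho cs w v = 0 ↔ v = 0 :=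
  ⟨fun h => rho_inj cs w (by simpa using h), fun h => by simp [h]⟩

theorem descent_iff (w : W) (i : B) :
    cs.length (w * cs.simple i) < cs.length w ↔ rho cs w (al i) ≤ 0 := by
  refine ⟨rho_nonpos cs w i, fun h => ?_⟩
  by_contra hcon
  have h2 := rho_nonneg cs w i (by have := cs.length_mul_simple w i; omega)
  exact al_ne_zero i ((rho_eq_zero_iff cs w _).1 (le_antisymm h h2))

theorem ascent_iff (w : W) (i : B) :
    cs.length w < cs.length (w * cs.simple i) ↔ 0 ≤ rho cs w (al i) := by
  refine ⟨rho_nonneg cs w i, fun h => ?_⟩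
  by_contra hcon
  have h2 := rho_nonpos cs w i (by have := cs.length_mul_simple w i; omega)
  exact al_ne_zero i ((rho_eq_zero_iff cs w _).1 (le_antisymm h2 h))

theorem rho_faithful {w w' : W} (h : ∀ v, rho cs w v = rho cs w' v) : w = w' := by
  suffices h1 : ∀ w : W, (∀ v, rho cs w v = v) → w = 1 by
    have := h1 (w'⁻¹ * w) (fun v => by rw [rho_mul, h, rho_inv_rho])
    exact (inv_mul_eq_one.1 this).symm
  intro w hw
  by_contra hne
  obtain ⟨j, hj⟩ := cs.exists_rightDescent_of_ne_one hne
  have := (descent_iff cs w j).1 hj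
  rw [hw] at this
  exact al_ne_zero j (le_antisymm this (al_nonneg j))

/-- The set of roots -/
def IsRoot (b : B →₀ ℝ) : Prop := ∃ w i, b = rho cs w (al i)

variable {cs}

theorem isRoot_al (i : B) : IsRoot cs (al i) := ⟨1, i, by simp⟩

theorem IsRoot.rho {b : B →₀ ℝ} (h : IsRoot cs b) (w : W) : IsRoot cs (rho cs w b) := by
  obtain ⟨u, i, rfl⟩ := h
  exact ⟨w * u, i, by simp⟩

theorem IsRoot.neg {b : B →₀ ℝ} (h : IsRoot cs b) : IsRoot cs (-b) := by
  obtain ⟨u, i, rfl⟩ := h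
  exact ⟨u * cs.simple i, i, by rw [rho_mul, rho_simple_self, map_neg]⟩

theorem IsRoot.norm {b : B →₀ ℝ} (h : IsRoot cs b) : bf M b b = 1 := by
  obtain ⟨u, i, rfl⟩ := h
  rw [bf_rho, bf_al_self]

theorem IsRoot.ne_zero {b : B →₀ ℝ} (h : IsRoot cs b) : b ≠ 0 := by
  rintro rfl; have := h.norm; simp at this

theorem IsRoot.pos_or_neg {b : B →₀ ℝ} (h : IsRoot cs b) : 0 ≤ b ∨ b ≤ 0 := by
  obtain ⟨u, i, rfl⟩ := h
  have := cs.length_mul_simple u i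
  by_cases h : cs.length u < cs.length (u * cs.simple i)
  · exact Or.inl (rho_nonneg cs u i h)
  · exact Or.inr (rho_nonpos cs u i (by omega))

theorem IsRoot.exists_refl {b : B →₀ ℝ} (h : IsRoot cs b) :
    ∃ r, cs.IsReflection r ∧ ∀ v, CoxRefl.rho cs r v = v - (2 * bf M b v) • b := by
  obtain ⟨u, i, rfl⟩ := h
  refine ⟨u * cs.simple i * u⁻¹, ⟨u, i, rfl⟩, fun v => ?_⟩
  rw [rho_mul, rho_mul, rho_simple, sg_apply, map_sub, map_smul, rho_rho_inv, bf_rho_left]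

/-- proportional positive roots are equal -/
theorem IsRoot.eq_of_smul {b : B →₀ ℝ} (h : IsRoot cs b) (i : B) (c : ℝ) (hb : 0 ≤ b)
    (hc : b = c • al i) : b = al i := by
  have h1 := h.norm
  rw [hc] at h1
  simp only [map_smul, LinearMap.smul_apply, bf_al_self, smul_eq_mul, mul_one] at h1
  have h2 : 0 ≤ c := by have := hb i; rw [hc] at this; simpa [al] using this
  have : c = 1 := by nlinarith
  rw [hc, this, one_smul]

theorem IsRoot.simple_perm {b : B →₀ ℝ} (h : IsRoot cs b) (i : B) (hb : 0 ≤ b) (hi : b ≠ al i) :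
    0 ≤ CoxRefl.rho cs (cs.simple i) b := by
  refine ((h.rho (cs.simple i)).pos_or_neg).resolve_right (fun hneg => ?_)
  apply hi
  refine h.eq_of_smul i (b i) hb ?_
  ext k
  by_cases hk : k = i
  · subst hk; simp [al]
  · have h1 := hneg k
    have h2 := hb k
    rw [rho_simple, sg_apply] at h1
    simp [al, Ne.symm hk] at h1 h2 ⊢
    linarith

theorem finite_neg (w : W) : {b | IsRoot cs b ∧ 0 ≤ b ∧ rho cs w b ≤ 0}.Finite := by
  induction w using cs.simple_induction_left with
  | one =>
    refine Set.Finite.subset (Set.finite_empty) ?_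
    rintro b ⟨h1, h2, h3⟩
    rw [rho_one] at h3
    exact h1.ne_zero (le_antisymm h3 h2)
  | mul_simple_left w i ih =>
    refine (ih.union (Set.finite_singleton (rho cs w⁻¹ (al i)))).subset ?_
    rintro b ⟨h1, h2, h3⟩
    by_cases h4 : rho cs w b ≤ 0
    · exact Or.inl ⟨h1, h2, h4⟩
    right
    have h5 := (h1.rho w).pos_or_neg.resolve_right h4
    by_contra h6
    have h7 : rho cs w b ≠ al i := by
      intro h; apply h6; rw [Set.mem_singleton_iff, ← h, rho_inv_rho]
    have h8 := (h1.rho w).simple_perm i h5 h7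
    rw [rho_mul] at h3
    have := le_antisymm h3 h8
    rw [← rho_mul, rho_eq_zero_iff] at this
    exact h1.ne_zero this

end CoxRefl

namespace CoxRefl

open CoxeterSystem

variable {B W : Type*} [Group W] {M : CoxeterMatrix B} (cs : CoxeterSystem M W)

/-- standard parabolic subgroup -/
def par (J : Set B) : Subgroup W := Subgroup.closure (cs.simple '' J)

noncomputable abbrev VV (J : Set B) : Submodule ℝ (B →₀ ℝ) := Finsupp.supported ℝ ℝ J

variable {cs}

theorem mem_VV {J : Set B} {v : B →₀ ℝ} : v ∈ VV J ↔ ∀ k, k ∉ J → v k = 0 :=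
  Finsupp.mem_supported' ℝ v

theorem al_mem_VV {J : Set B} {j : B} (h : j ∈ J) : al j ∈ VV J := by
  rw [mem_VV]; intro k hk; exact al_apply_ne (by rintro rfl; exact hk h)

theorem mem_of_al_mem_VV {J : Set B} {j : B} (h : al j ∈ VV J) : j ∈ J := by
  by_contra hj
  have := mem_VV.1 h j hj
  rw [al_apply_self] at this
  exact one_ne_zero this

theorem VV_eq_span (J : Set B) : VV J = Submodule.span ℝ (al '' J) :=
  Finsupp.supported_eq_span_single ℝ J

theorem par_mono {J K : Set B} (h : J ⊆ K) : par cs J ≤ par cs K :=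
  Subgroup.closure_mono (Set.image_mono h)

theorem simple_mem_par {J : Set B} {j : B} (h : j ∈ J) : cs.simple j ∈ par cs J :=
  Subgroup.subset_closure ⟨j, h, rfl⟩

theorem par_sub {J : Set B} {w : W} (hw : w ∈ par cs J) (v : B →₀ ℝ) : rho cs w v - v ∈ VV J := by
  induction hw using Subgroup.closure_induction generalizing v with
  | mem x hx =>
    obtain ⟨j, hj, rfl⟩ := hx
    rw [rho_simple, sg_apply, sub_sub_cancel_left]
    exact neg_mem (Submodule.smul_mem _ _ (al_mem_VV hj))
  | one => simp
  | mul x y _ _ hx hy =>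
    have := add_mem (hx (rho cs y v)) (hy v)
    rw [rho_mul]; simpa using this
  | inv x _ hx =>
    have := neg_mem (hx (rho cs x⁻¹ v))
    rw [rho_rho_inv] at this
    simpa using this

theorem par_VV {J : Set B} {w : W} (hw : w ∈ par cs J) {v : B →₀ ℝ} (hv : v ∈ VV J) :
    rho cs w v ∈ VV J := by
  have := add_mem (par_sub hw v) hv
  simpa using this

theorem descent_mem {J : Set B} {w : W} (hw : ∀ v, rho cs w v - v ∈ VV J) {j : B}
    (h : rho cs w (al j) ≤ 0) : j ∈ J := by
  by_contra hj
  have h1 := mem_VV.1 (hw (al j)) j hj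
  have h2 := h j
  simp [al] at h1 h2
  linarith

theorem mem_par_of_sub {J : Set B} {w : W} (hw : ∀ v, rho cs w v - v ∈ VV J) : w ∈ par cs J := by
  induction hn : cs.length w using Nat.strong_induction_on generalizing w with
  | _ n IH =>
  by_cases h1 : w = 1
  · rw [h1]; exact one_mem _
  obtain ⟨j, hj⟩ := cs.exists_rightDescent_of_ne_one h1
  have hjJ := descent_mem hw ((descent_iff cs w j).1 hj)
  have hs : cs.simple j ∈ par cs J := simple_mem_par hjJ
  have := IH (cs.length (w * cs.simple j)) (hn ▸ hj) (w := w * cs.simple j) (fun v => by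
    rw [rho_mul]
    have := add_mem (hw (rho cs (cs.simple j) v)) (par_sub hs v)
    simpa using this) rfl
  have := mul_mem this hs
  simpa using this

theorem exists_descent {J : Set B} {w : W} (hw : w ∈ par cs J) (h1 : w ≠ 1) :
    ∃ j ∈ J, cs.length (w * cs.simple j) < cs.length w ∧ rho cs w (al j) ≤ 0 := by
  obtain ⟨j, hj⟩ := cs.exists_rightDescent_of_ne_one h1
  have h2 := (descent_iff cs w j).1 hj
  exact ⟨j, descent_mem (par_sub hw) h2, hj, h2⟩

theorem par_eq_one {J : Set B} {w : W} (hw : w ∈ par cs J)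
    (h : ∀ j ∈ J, rho cs w (al j) = al j) : w = 1 := by
  by_contra h1
  obtain ⟨j, hj, _, h2⟩ := exists_descent hw h1
  rw [h j hj] at h2
  exact al_ne_zero j (le_antisymm h2 (al_nonneg j))

theorem par_finite_of_pos {K : Set B} (hK : K.Finite)
    (h : {b | IsRoot cs b ∧ 0 ≤ b ∧ b ∈ VV K}.Finite) : (par cs K : Set W).Finite := by
  have h' : {b | IsRoot cs b ∧ b ∈ VV K}.Finite := by
    refine (h.union (h.image (fun b => -b))).subset ?_
    rintro b ⟨h1, h2⟩
    rcases h1.pos_or_neg with h3 | h3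
    · exact Or.inl ⟨h1, h3, h2⟩
    · exact Or.inr ⟨-b, ⟨h1.neg, by simpa using h3, neg_mem h2⟩, by simp⟩
  have : Finite K := hK
  have hpi : (Set.pi Set.univ (fun _ : K => {b | IsRoot cs b ∧ b ∈ VV K})).Finite :=
    Set.Finite.pi (fun _ => h')
  refine Set.Finite.of_injOn (f := fun w (k : K) => rho cs w (al (k : B))) ?_ ?_ hpi
  · intro w hw k _
    exact ⟨(isRoot_al _).rho w, par_VV hw (al_mem_VV k.2)⟩
  · intro w hw w' hw' he
    have := par_eq_one (mul_mem (inv_mem hw') hw) (fun j hj => by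
      have := congrFun he ⟨j, hj⟩
      simp only at this
      rw [rho_mul, this, rho_inv_rho])
    exact (inv_mul_eq_one.1 this).symm

/-- sum of coordinates -/
noncomputable def ht : (B →₀ ℝ) →ₗ[ℝ] ℝ := Finsupp.linearCombination ℝ (fun _ => (1 : ℝ))

theorem ht_eq (v : B →₀ ℝ) : ht v = ∑ k ∈ v.support, v k := by
  simp [ht, Finsupp.linearCombination_apply, Finsupp.sum]

theorem ht_al (i : B) : ht (al i) = 1 := by simp [ht, al]

theorem ht_pos {v : B →₀ ℝ} (hv : 0 ≤ v) (h0 : v ≠ 0) : 0 < ht v := by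
  rw [ht_eq]
  apply Finset.sum_pos
  · intro k hk
    have := hv k
    have h2 := Finsupp.mem_support_iff.1 hk
    exact lt_of_le_of_ne this (Ne.symm h2)
  · exact Finsupp.support_nonempty_iff.2 h0

/-- a functional nonneg on simple roots of J is nonneg on V_J^+ -/
theorem fun_nonneg {J : Set B} {x : (B →₀ ℝ) →ₗ[ℝ] ℝ} (hx : ∀ j ∈ J, 0 ≤ x (al j))
    {v : B →₀ ℝ} (hv : 0 ≤ v) (hJ : v ∈ VV J) : 0 ≤ x v := by
  have h1 : v = ∑ k ∈ v.support, v k • al k := by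
    conv_lhs => rw [← Finsupp.sum_single v]
    simp [Finsupp.sum, al]
  rw [h1, map_sum]
  apply Finset.sum_nonneg
  intro k hk
  rw [map_smul, smul_eq_mul]
  have hkJ : k ∈ J := by
    by_contra hh; exact Finsupp.mem_support_iff.1 hk (mem_VV.1 hJ k hh)
  exact mul_nonneg (hv k) (hx k hkJ)

theorem fun_eq_zero {J : Set B} {x : (B →₀ ℝ) →ₗ[ℝ] ℝ} (hx : ∀ j ∈ J, x (al j) = 0)
    {v : B →₀ ℝ} (hJ : v ∈ VV J) : x v = 0 := by
  have : VV J ≤ LinearMap.ker x := by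
    rw [VV_eq_span, Submodule.span_le]
    rintro _ ⟨j, hj, rfl⟩
    exact hx j hj
  exact this hJ

theorem exists_fixed {H : Subgroup W} (hH : (H : Set W).Finite) :
    ∃ x : (B →₀ ℝ) →ₗ[ℝ] ℝ, (∀ h ∈ H, ∀ v, x (rho cs h v) = x v) ∧
      {b | IsRoot cs b ∧ 0 ≤ b ∧ x b ≤ 0}.Finite := by
  classical
  have : Finite H := hH
  have : Fintype H := Fintype.ofFinite H
  refine ⟨∑ h : H, ht ∘ₗ (rho cs h), ?_, ?_⟩
  · intro h hh v
    simp only [LinearMap.sum_apply, LinearMap.comp_apply]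
    refine Fintype.sum_equiv (Equiv.mulRight ⟨h, hh⟩) _ _ (fun k => ?_)
    simp
  · refine (Set.finite_iUnion (fun h : H => finite_neg (cs := cs) (h : W))).subset ?_
    rintro b ⟨h1, h2, h3⟩
    rw [Set.mem_iUnion]
    by_contra! hcon
    have : 0 < ∑ h : H, ht (rho cs h b) := by
      apply Finset.sum_pos
      · intro h _
        have h4 := hcon h
        have h5 := (h1.rho (h : W))
        exact ht_pos (h5.pos_or_neg.resolve_right (fun h6 => h4 ⟨h1, h2, h6⟩)) h5.ne_zero
      · exact ⟨1, Finset.mem_univ _⟩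
    simp only [LinearMap.sum_apply, LinearMap.comp_apply] at h3
    linarith

theorem exists_dominant (x : (B →₀ ℝ) →ₗ[ℝ] ℝ) (hx : {b | IsRoot cs b ∧ 0 ≤ b ∧ x b < 0}.Finite) :
    ∃ g, ∀ i, 0 ≤ x (rho cs g (al i)) := by
  induction hn : {b | IsRoot cs b ∧ 0 ≤ b ∧ x b < 0}.ncard using Nat.strong_induction_on generalizing x with
  | _ n IH =>
  by_cases h : ∀ i, 0 ≤ x (al i)
  · exact ⟨1, by simpa using h⟩
  push Not at h
  obtain ⟨i, hi⟩ := h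
  have key : (fun b => rho cs (cs.simple i) b) ''
      {b | IsRoot cs b ∧ 0 ≤ b ∧ (x ∘ₗ rho cs (cs.simple i)) b < 0} ⊆
      {b | IsRoot cs b ∧ 0 ≤ b ∧ x b < 0} \ {al i} := by
    rintro _ ⟨b, ⟨h1, h2, h3⟩, rfl⟩
    simp only [LinearMap.comp_apply] at h3
    have hne : b ≠ al i := by
      rintro rfl; rw [rho_simple_self, map_neg] at h3; linarith
    refine ⟨⟨h1.rho _, h1.simple_perm i h2 hne, h3⟩, ?_⟩
    intro he
    rw [Set.mem_singleton_iff] at he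
    have : b = - al i := by
      rw [← rho_simple_self cs i, ← he, ← rho_mul]; simp
    rw [this] at h2
    have := h2 i
    simp [al] at this
    linarith
  have hinj : Set.InjOn (fun b => rho cs (cs.simple i) b)
      {b | IsRoot cs b ∧ 0 ≤ b ∧ (x ∘ₗ rho cs (cs.simple i)) b < 0} :=
    fun a _ b _ hab => rho_inj cs _ hab
  have hfin : ({b | IsRoot cs b ∧ 0 ≤ b ∧ x b < 0} \ {al i}).Finite := hx.sdiff
  have hf' : {b | IsRoot cs b ∧ 0 ≤ b ∧ (x ∘ₗ rho cs (cs.simple i)) b < 0}.Finite :=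
    Set.Finite.of_finite_image (hfin.subset key) hinj
  have hlt : {b | IsRoot cs b ∧ 0 ≤ b ∧ (x ∘ₗ rho cs (cs.simple i)) b < 0}.ncard < n := by
    rw [← hinj.ncard_image]
    refine (Set.ncard_le_ncard key hfin).trans_lt ?_
    rw [← hn]
    exact Set.ncard_sdiff_singleton_lt_of_mem ⟨isRoot_al i, al_nonneg i, hi⟩ hx
  obtain ⟨g, hg⟩ := IH _ hlt _ hf' rfl
  exact ⟨cs.simple i * g, fun k => by rw [rho_mul]; exact hg k⟩

theorem stab_dominant {J : Set B} {x : (B →₀ ℝ) →ₗ[ℝ] ℝ} (hx : ∀ j ∈ J, 0 ≤ x (al j))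
    {w : W} (hw : w ∈ par cs J) (hfix : ∀ v ∈ VV J, x (rho cs w v) = x v) :
    w ∈ par cs {j ∈ J | x (al j) = 0} := by
  induction hn : cs.length w using Nat.strong_induction_on generalizing w with
  | _ n IH =>
  by_cases h1 : w = 1
  · rw [h1]; exact one_mem _
  obtain ⟨j, hj, hl, hneg⟩ := exists_descent hw h1
  have hxj : x (al j) = 0 := by
    apply le_antisymm _ (hx j hj)
    rw [← hfix _ (al_mem_VV hj)]
    have := fun_nonneg hx (v := - rho cs w (al j)) (by simpa using hneg) (neg_mem (par_VV hw (al_mem_VV hj)))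
    rw [map_neg] at this
    linarith
  have hs : cs.simple j ∈ par cs {j ∈ J | x (al j) = 0} := simple_mem_par ⟨hj, hxj⟩
  have hs' : cs.simple j ∈ par cs J := simple_mem_par hj
  have := IH _ (hn ▸ hl) (w := w * cs.simple j) (mul_mem hw hs') (fun v hv => by
    rw [rho_mul, hfix _ (par_VV hs' hv), rho_simple, sg_apply, map_sub, map_smul, hxj]
    simp) rfl
  have := mul_mem this hs
  simpa using this

theorem conj_into_par {H : Subgroup W} (hH : (H : Set W).Finite) :
    ∃ g : W, ∃ K : Set B, K.Finite ∧ (par cs K : Set W).Finite ∧ ∀ h ∈ H, g⁻¹ * h * g ∈ par cs K := by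
  obtain ⟨x, hx1, hx2⟩ := exists_fixed (cs := cs) hH
  obtain ⟨g, hg⟩ := exists_dominant (cs := cs) x (hx2.subset (fun b hb => ⟨hb.1, hb.2.1, hb.2.2.le⟩))
  set y := x ∘ₗ rho cs g with hy
  have hfin : {b | IsRoot cs b ∧ 0 ≤ b ∧ y b ≤ 0}.Finite := by
    refine ((finite_neg (cs := cs) g).union (hx2.image (fun b => rho cs g⁻¹ b))).subset ?_
    rintro b ⟨h1, h2, h3⟩
    rcases (h1.rho g).pos_or_neg with h4 | h4
    · exact Or.inr ⟨rho cs g b, ⟨h1.rho g, h4, h3⟩, rho_inv_rho cs g b⟩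
    · exact Or.inl ⟨h1, h2, h4⟩
  refine ⟨g, {j ∈ Set.univ | y (al j) = 0}, ?_, ?_, ?_⟩
  · refine Set.Finite.of_injOn (f := al) ?_ ?_ hfin
    · rintro j ⟨_, hj⟩
      exact ⟨isRoot_al j, al_nonneg j, hj.le⟩
    · intro a _ b _ hab
      exact Finsupp.single_left_injective one_ne_zero hab
  · apply par_finite_of_pos
    · refine Set.Finite.of_injOn (f := al) ?_ ?_ hfin
      · rintro j ⟨_, hj⟩
        exact ⟨isRoot_al j, al_nonneg j, hj.le⟩
      · intro a _ b _ hab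
        exact Finsupp.single_left_injective one_ne_zero hab
    · refine hfin.subset ?_
      rintro b ⟨h1, h2, h3⟩
      refine ⟨h1, h2, le_of_eq ?_⟩
      exact fun_eq_zero (x := y) (fun j hj => hj.2) h3
  · intro h hh
    apply stab_dominant (fun j _ => hg j)
    · apply mem_par_of_sub
      intro v; rw [mem_VV]; simp
    · intro v _
      simp only [hy, LinearMap.comp_apply, rho_mul, rho_rho_inv]
      exact hx1 h hh _

end CoxRefl

namespace CoxRefl

open CoxeterSystem

variable {B W : Type*} [Group W] {M : CoxeterMatrix B} {cs : CoxeterSystem M W}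

theorem posdef {K : Set B} (hK : K.Finite) (hP : (par cs K : Set W).Finite)
    {v : B →₀ ℝ} (hv : v ∈ VV K) (h0 : v ≠ 0) : 0 < bf M v v := by
  classical
  have : Finite (par cs K) := hP
  have : Fintype (par cs K) := Fintype.ofFinite _
  let E : (B →₀ ℝ) →ₗ[ℝ] (B →₀ ℝ) →ₗ[ℝ] ℝ :=
    ∑ h : par cs K, ∑ k ∈ hK.toFinset,
      ((LinearMap.mul ℝ ℝ).compl₁₂ ((Finsupp.lapply k) ∘ₗ rho cs (h : W)) ((Finsupp.lapply k) ∘ₗ rho cs (h : W)))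
  have hE : ∀ u v, E u v = ∑ h : par cs K, ∑ k ∈ hK.toFinset, (rho cs (h : W) u) k * (rho cs (h : W) v) k := by
    intro u v
    simp [E, LinearMap.sum_apply]
  have hinv : ∀ g ∈ par cs K, ∀ u v, E (rho cs g u) (rho cs g v) = E u v := by
    intro g hg u v
    rw [hE, hE]
    refine Fintype.sum_equiv (Equiv.mulRight ⟨g, hg⟩) _ _ (fun k => ?_)
    simp
  have hpos : ∀ u ∈ VV K, u ≠ 0 → 0 < E u u := by
    intro u hu hu0
    rw [hE]
    apply Finset.sum_pos'
    · intro h _; exact Finset.sum_nonneg (fun k _ => mul_self_nonneg _)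
    · refine ⟨1, Finset.mem_univ _, ?_⟩
      apply Finset.sum_pos'
      · intro k _; exact mul_self_nonneg _
      · obtain ⟨k, hk⟩ := Finsupp.ne_iff.1 hu0
        refine ⟨k, ?_, ?_⟩
        · rw [Set.Finite.mem_toFinset]; by_contra hh; exact hk (mem_VV.1 hu k hh)
        · simp only [OneMemClass.coe_one, rho_one]
          exact mul_self_pos.2 hk
  have hsymm : ∀ u v, E u v = E v u := by
    intro u v; rw [hE, hE]; simp only [mul_comm]
  set n : B → ℝ := fun i => E (al i) (al i) with hn
  have hnpos : ∀ i ∈ K, 0 < n i := fun i hi => hpos _ (al_mem_VV hi) (al_ne_zero i)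
  have hrel : ∀ i ∈ K, ∀ v, E (al i) v = bf M (al i) v * n i := by
    intro i hi v
    have h1 := hinv _ (simple_mem_par hi) (al i) v
    rw [rho_simple_self, rho_simple, sg_apply] at h1
    simp only [map_neg, map_sub, map_smul, LinearMap.neg_apply, smul_eq_mul] at h1
    simp only [hn]
    linarith
  have hrel2 : ∀ i ∈ K, ∀ j ∈ K,
      bf M (al i) (al j) = (1 / √(n i)) * (1 / √(n j)) * E (al i) (al j) := by
    intro i hi j hj
    have e1 := hrel i hi (al j)
    have e2 := hrel j hj (al i)
    rw [hsymm, bf_symm] at e2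
    by_cases hz : bf M (al i) (al j) = 0
    · rw [e1, hz]; simp
    · have : n i = n j := by
        have : bf M (al i) (al j) * n i = bf M (al i) (al j) * n j := by rw [← e1, ← e2]
        exact mul_left_cancel₀ hz this
      have hni := hnpos i hi
      rw [← this, e1, ← mul_div_mul_comm, Real.mul_self_sqrt hni.le]
      field_simp
  set v' : B →₀ ℝ := ∑ k ∈ hK.toFinset, (v k * (1 / √(n k))) • al k with hv'
  have hvs : v = ∑ k ∈ hK.toFinset, v k • al k := by
    have h1 : v = ∑ k ∈ v.support, v k • al k := by
      conv_lhs => rw [← Finsupp.sum_single v]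
      simp [Finsupp.sum, al]
    conv_lhs => rw [h1]
    apply Finset.sum_subset
    · intro k hk
      rw [Set.Finite.mem_toFinset]; by_contra hh; exact Finsupp.mem_support_iff.1 hk (mem_VV.1 hv k hh)
    · intro k _ hk
      rw [Finsupp.notMem_support_iff.1 hk, zero_smul]
  have hbE : bf M v v = E v' v' := by
    conv_lhs => rw [hvs]
    rw [hv']
    simp only [map_sum, LinearMap.sum_apply, map_smul, LinearMap.smul_apply, smul_eq_mul]
    apply Finset.sum_congr rfl
    intro i hi
    rw [Finset.mul_sum, Finset.mul_sum]
    apply Finset.sum_congr rfl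
    intro j hj
    rw [Set.Finite.mem_toFinset] at hi hj
    rw [hrel2 _ hj _ hi]
    ring
  rw [hbE]
  apply hpos
  · exact Submodule.sum_mem _ (fun k hk => Submodule.smul_mem _ _ (al_mem_VV (hK.mem_toFinset.1 hk)))
  · obtain ⟨k, hk⟩ := Finsupp.ne_iff.1 h0
    have hkK : k ∈ K := by by_contra hh; exact hk (mem_VV.1 hv k hh)
    apply Finsupp.ne_iff.2 ⟨k, ?_⟩
    have hnk := hnpos k hkK
    have hk' : v k ≠ 0 := hk
    have : v' k = v k * (1 / √(n k)) := by
      rw [hv', Finsupp.finsetSum_apply]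
      rw [Finset.sum_eq_single k]
      · simp [al]
      · intro b _ hb; simp [al, hb]
      · intro hh; exact absurd (hK.mem_toFinset.2 hkK) hh
    rw [this]
    have : √(n k) ≠ 0 := (Real.sqrt_pos.2 hnk).ne'
    simp [hk', this]

variable (cs) in
/-- `[V, Q]` -/
noncomputable def mv (Q : Subgroup W) : Submodule ℝ (B →₀ ℝ) :=
  Submodule.span ℝ {u | ∃ q ∈ Q, ∃ v, u = rho cs q v - v}

theorem sub_mem_mv {Q : Subgroup W} {q : W} (hq : q ∈ Q) (v : B →₀ ℝ) : rho cs q v - v ∈ mv cs Q :=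
  Submodule.subset_span ⟨q, hq, v, rfl⟩

theorem mv_le {Q : Subgroup W} {L : Submodule ℝ (B →₀ ℝ)} (h : ∀ q ∈ Q, ∀ v, rho cs q v - v ∈ L) :
    mv cs Q ≤ L := by
  rw [mv, Submodule.span_le]
  rintro _ ⟨q, hq, v, rfl⟩
  exact h q hq v

theorem mv_mono {Q Q' : Subgroup W} (h : Q ≤ Q') : mv cs Q ≤ mv cs Q' :=
  mv_le (fun _ hq v => sub_mem_mv (h hq) v)

/-- L1 -/
theorem exists_std {Q : Subgroup W} (hQ : (Q : Set W).Finite) :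
    ∃ g : W, ∃ J : Set B, J.Finite ∧ (par cs J : Set W).Finite ∧
      (∀ q ∈ Q, g⁻¹ * q * g ∈ par cs J) ∧ mv cs Q = (VV J).map (rho cs g) := by
  obtain ⟨g, J, hJ, hP, hg⟩ := conj_into_par (cs := cs) hQ
  induction hn : J.ncard using Nat.strong_induction_on generalizing g J with
  | _ n IH =>
  have hle : mv cs Q ≤ (VV J).map (rho cs g) := by
    apply mv_le
    intro q hq v
    refine ⟨rho cs (g⁻¹ * q * g) (rho cs g⁻¹ v) - rho cs g⁻¹ v, par_sub (hg q hq) _, ?_⟩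
    rw [map_sub, rho_rho_inv, ← rho_mul, ← rho_mul]
    group
  by_cases heq : mv cs Q = (VV J).map (rho cs g)
  · exact ⟨g, J, hJ, hP, hg, heq⟩
  have hlt : ¬ (VV J).map (rho cs g) ≤ mv cs Q := fun h => heq (le_antisymm hle h)
  classical
  have : Finite Q := hQ
  have : Fintype Q := Fintype.ofFinite Q
  have : Finite (par cs J) := hP
  obtain ⟨_, ⟨v, hv, rfl⟩, hvn⟩ := SetLike.not_le_iff_exists.1 hlt
  set a := ∑ q : Q, rho cs (q : W) (rho cs g v) with ha
  have ha0 : a ≠ 0 := by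
    intro h0
    apply hvn
    have : (Fintype.card Q : ℝ) • rho cs g v = - ∑ q : Q, (rho cs (q : W) (rho cs g v) - rho cs g v) := by
      rw [Finset.sum_sub_distrib, ← ha, h0]
      simp [Nat.cast_smul_eq_nsmul]
    have h2 : (Fintype.card Q : ℝ) • rho cs g v ∈ mv cs Q := by
      rw [this]
      exact neg_mem (Submodule.sum_mem _ (fun q _ => sub_mem_mv q.2 _))
    exact (Submodule.smul_mem_iff _ (by simp)).1 h2
  have hafix : ∀ q ∈ Q, rho cs q a = a := by
    intro q hq
    rw [ha, map_sum]
    refine Fintype.sum_equiv (Equiv.mulLeft ⟨q, hq⟩) _ _ (fun k => ?_)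
    simp
  have haV : rho cs g⁻¹ a ∈ VV J := by
    rw [ha, map_sum]
    apply Submodule.sum_mem
    intro q _
    rw [← rho_mul, ← rho_mul]
    exact par_VV (hg q q.2) hv
  set u := rho cs g⁻¹ a with hu
  obtain ⟨h, hh⟩ := Finite.exists_max (fun h : par cs J => ht (rho cs (h : W) u))
  set u' := rho cs (h : W) u with hu'
  have hu'V : u' ∈ VV J := par_VV h.2 haV
  have hu'0 : u' ≠ 0 := by
    rw [hu', Ne, rho_eq_zero_iff, hu, rho_eq_zero_iff]; exact ha0
  have hdom : ∀ j ∈ J, 0 ≤ bf M u' (al j) := by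
    intro j hj
    have := hh (⟨cs.simple j, simple_mem_par hj⟩ * h)
    simp only [Subgroup.coe_mul, rho_mul] at this
    rw [← hu', rho_simple, sg_apply, map_sub, map_smul, ht_al, smul_eq_mul, bf_symm] at this
    linarith
  set J' := {j ∈ J | bf M u' (al j) = 0} with hJ'
  have hsub : J' ⊆ J := fun j hj => hj.1
  have hssub : J' ⊂ J := by
    refine ⟨hsub, fun hcon => ?_⟩
    have h1 := fun_eq_zero (x := bf M u') (fun j hj => (hcon hj).2) hu'V
    have h2 := posdef hJ hP hu'V hu'0
    linarith
  refine IH J'.ncard (hn ▸ Set.ncard_lt_ncard hssub hJ) (g * (h : W)⁻¹) J' (hJ.subset hsub)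
    (hP.subset (par_mono hsub)) ?_ rfl
  intro q hq
  have hmem : (g * (h : W)⁻¹)⁻¹ * q * (g * (h : W)⁻¹) ∈ par cs J := by
    have := mul_mem (mul_mem h.2 (hg q hq)) (inv_mem h.2)
    convert this using 1
    group
  have hqu : rho cs ((g * (h : W)⁻¹)⁻¹ * q * (g * (h : W)⁻¹))⁻¹ u' = u' := by
    have : rho cs ((g * (h : W)⁻¹)⁻¹ * q * (g * (h : W)⁻¹))⁻¹ (rho cs (h : W) (rho cs g⁻¹ a)) =
        rho cs ((h : W) * g⁻¹ * q⁻¹) a := by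
      simp only [← rho_mul]; group
    rw [hu', hu, this, rho_mul, hafix _ (inv_mem hq), rho_mul]
  refine stab_dominant hdom hmem (fun v _ => ?_)
  rw [bf_symm, bf_rho_left, hqu, bf_symm]

end CoxRefl

namespace CoxRefl

open CoxeterSystem

variable {B W : Type*} [Group W] {M : CoxeterMatrix B} {cs : CoxeterSystem M W}

/-- conjugate subgroup -/
def cj (u : W) (Q : Subgroup W) : Subgroup W := Q.map (MulAut.conj u).toMonoidHom

theorem mem_cj {u x : W} {Q : Subgroup W} : x ∈ cj u Q ↔ u⁻¹ * x * u ∈ Q := by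
  constructor
  · rintro ⟨y, hy, rfl⟩
    have : u⁻¹ * ((MulAut.conj u).toMonoidHom y) * u = y := by
      simp [mul_assoc]
    rw [this]; exact hy
  · intro h
    exact ⟨_, h, by simp [mul_assoc]⟩

theorem cj_finite {u : W} {Q : Subgroup W} (h : (Q : Set W).Finite) : (cj u Q : Set W).Finite := by
  rw [cj, Subgroup.coe_map]; exact h.image _

theorem refl_sq (i : B) : cs.simple i * cs.simple i = 1 := cs.simple_mul_simple_self i

/-- elements acting as reflections are determined by the root up to sign -/
theorem conj_simple {x r : W} {i : B} {b : B →₀ ℝ} {e : ℝ} (he : e = 1 ∨ e = -1)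
    (hr : ∀ v, rho cs r v = v - (2 * bf M b v) • b) (h : rho cs x (al i) = e • b) :
    x * cs.simple i * x⁻¹ = r := by
  apply rho_faithful cs
  intro v
  rw [rho_mul, rho_mul, rho_simple, sg_apply, map_sub, map_smul, rho_rho_inv, hr,
    ← bf_rho_left, h]
  rcases he with rfl | rfl
  · simp
  · simp

theorem conj_simple' {x : W} {i j : B} {e : ℝ} (he : e = 1 ∨ e = -1)
    (h : rho cs x (al i) = e • al j) : x * cs.simple i * x⁻¹ = cs.simple j :=
  conj_simple he (fun v => by rw [rho_simple, sg_apply]) h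

theorem comm_simple {x : W} {i : B} {e : ℝ} (he : e = 1 ∨ e = -1)
    (h : rho cs x (al i) = e • al i) : x * cs.simple i = cs.simple i * x :=
  mul_inv_eq_iff_eq_mul.1 (conj_simple' he h)

theorem simple_inj {i j : B} (h : cs.simple i = cs.simple j) : i = j := by
  by_contra hij
  have h1 := congrArg (fun w => rho cs w (al i) i) h
  simp only [rho_simple_self] at h1
  rw [rho_simple, sg_apply] at h1
  simp [al, Ne.symm hij] at h1
  linarith

theorem par_singleton {i : B} {w : W} (hw : w ∈ par cs {i}) : w = 1 ∨ w = cs.simple i := by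
  by_contra! h
  obtain ⟨j, hj, h1, h2⟩ := exists_descent hw h.1
  obtain rfl : j = i := hj
  have h3 : w * cs.simple j ∈ par cs {j} := mul_mem hw (simple_mem_par rfl)
  obtain ⟨k, hk, h4, h5⟩ := exists_descent h3 (fun h' => h.2 (by
    have := mul_eq_one_iff_eq_inv.1 h'; simpa using this))
  obtain rfl : k = j := hk
  simp at h4
  omega

/-- The data attached to a simple reflection which is not a reflection for another structure;
`R` is the other set of reflections. -/
structure Bad (cs : CoxeterSystem M W) (R : W → Prop) (i : B) (Q : Subgroup W) : Prop where
  mem : cs.simple i ∈ Q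
  comm : ∀ q ∈ Q, q * cs.simple i = cs.simple i * q
  norm : ∀ c, c * cs.simple i = cs.simple i * c → ∀ q ∈ Q, c * q * c⁻¹ ∈ Q
  sup : ∀ H : Subgroup W, (H : Set W).Finite → cs.simple i ∈ H → ((H ⊔ Q : Subgroup W) : Set W).Finite
  two : ∃ a ∈ Q, ∃ b ∈ Q, a ≠ b ∧ a ≠ 1 ∧ b ≠ 1 ∧ a ≠ cs.simple i ∧ b ≠ cs.simple i ∧ R a ∧ R b
  nr : ¬ R (cs.simple i)
  conj : ∀ w g, R w → R (g * w * g⁻¹)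

theorem Bad.conjQ {R : W → Prop} {i j : B} {Q : Subgroup W} (h : Bad cs R i Q) {u : W}
    (hu : u * cs.simple i * u⁻¹ = cs.simple j) : Bad cs R j (cj u Q) := by
  have hu' : u⁻¹ * cs.simple j * u = cs.simple i := by rw [← hu]; group
  have key : ∀ c, c * cs.simple j = cs.simple j * c → (u⁻¹ * c * u) * cs.simple i = cs.simple i * (u⁻¹ * c * u) := by
    intro c hc
    calc (u⁻¹ * c * u) * cs.simple i = u⁻¹ * (c * (u * cs.simple i * u⁻¹)) * u := by group
      _ = u⁻¹ * ((u * cs.simple i * u⁻¹) * c) * u := by rw [hu, hc]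
      _ = _ := by group
  refine ⟨?_, ?_, ?_, ?_, ?_, ?_, h.conj⟩
  · rw [mem_cj, hu']; exact h.mem
  · intro q hq
    rw [mem_cj] at hq
    have := h.comm _ hq
    rw [← hu]
    calc q * (u * cs.simple i * u⁻¹) = u * (u⁻¹ * q * u * cs.simple i) * u⁻¹ := by group
      _ = u * (cs.simple i * (u⁻¹ * q * u)) * u⁻¹ := by rw [this]
      _ = _ := by group
  · intro c hc q hq
    rw [mem_cj] at hq ⊢
    have := h.norm _ (key c hc) _ hq
    convert this using 1
    group
  · intro H hH hj
    have h1 := h.sup (CoxRefl.cj u⁻¹ H) (cj_finite hH) (by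
      rw [mem_cj]; rw [inv_inv, hu]; exact hj)
    refine (cj_finite (u := u) h1).subset ?_
    have : H ⊔ CoxRefl.cj u Q ≤ CoxRefl.cj u (CoxRefl.cj u⁻¹ H ⊔ Q) := by
      apply sup_le
      · intro x hx
        rw [mem_cj]
        apply Subgroup.mem_sup_left
        rw [mem_cj]
        convert hx using 1; group
      · intro x hx
        rw [mem_cj] at hx ⊢
        exact Subgroup.mem_sup_right hx
    exact this
  · obtain ⟨a, ha, b, hb, h1, h2, h3, h4, h5, h6, h7⟩ := h.two
    have hcj : ∀ x ∈ Q, u * x * u⁻¹ ∈ CoxRefl.cj u Q := by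
      intro x hx; rw [mem_cj]; convert hx using 1; group
    refine ⟨_, hcj a ha, _, hcj b hb, ?_, ?_, ?_, ?_, ?_, h.conj _ _ h6, h.conj _ _ h7⟩
    · simpa using h1
    · simpa using h2
    · simpa using h3
    · rw [← hu]; simpa using h4
    · rw [← hu]; simpa using h5
  · intro hR
    apply h.nr
    have := h.conj _ u⁻¹ hR
    rw [inv_inv, hu'] at this
    exact this

/-- the parabolic closure of a finite subgroup -/
theorem exists_closure {Q : Subgroup W} (hQ : (Q : Set W).Finite) :
    ∃ P : Subgroup W, (P : Set W).Finite ∧ ∀ x, x ∈ P ↔ ∀ v, rho cs x v - v ∈ mv cs Q := by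
  obtain ⟨g, J, hJ, hP, hg, heq⟩ := exists_std (cs := cs) hQ
  refine ⟨cj g (par cs J), cj_finite hP, fun x => ?_⟩
  rw [mem_cj, heq]
  constructor
  · intro h v
    refine ⟨rho cs (g⁻¹ * x * g) (rho cs g⁻¹ v) - rho cs g⁻¹ v, par_sub h _, ?_⟩
    rw [map_sub, rho_rho_inv, ← rho_mul, ← rho_mul]
    group
  · intro h
    apply mem_par_of_sub
    intro v
    obtain ⟨y, hy, hy2⟩ := h (rho cs g v)
    have : rho cs (g⁻¹ * x * g) v - v = y := by
      apply rho_inj cs g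
      rw [hy2, map_sub, ← rho_mul, ← rho_mul]
      group
    rw [this]; exact hy

variable {B' W' : Type*} [Group W'] {M' : CoxeterMatrix B'} {cs' : CoxeterSystem M' W'}

theorem exists_bad (f : W ≃* W') (i : B) (hnr : ¬ cs'.IsReflection (f (cs.simple i))) :
    ∃ Q, Bad cs (fun w => cs'.IsReflection (f w)) i Q := by
  set w := f (cs.simple i) with hw
  have hw2 : w * w = 1 := by rw [hw, ← map_mul, refl_sq, map_one]
  have hw1 : w ≠ 1 := by
    intro h
    rw [hw, map_eq_one_iff f f.injective] at h
    have := rho_simple_self cs i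
    rw [h, rho_one] at this
    have := congrArg (fun v => v i) this
    simp [al] at this
    linarith
  set Q0 := Subgroup.zpowers w with hQ0
  have hQ0fin : (Q0 : Set W').Finite := by
    have : IsOfFinOrder w := isOfFinOrder_iff_pow_eq_one.2 ⟨2, by norm_num, by rw [pow_two, hw2]⟩
    exact this.finite_zpowers
  have hwQ : w ∈ Q0 := Subgroup.mem_zpowers w
  have hQ0cases : ∀ q ∈ Q0, q = 1 ∨ q = w := by
    rintro q ⟨n, rfl⟩
    rcases Int.even_or_odd n with ⟨k, hk⟩ | ⟨k, hk⟩
    · left; simp only [hk, ← two_mul, zpow_mul, zpow_two, hw2, one_zpow]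
    · right; simp only [hk, zpow_add, zpow_mul, zpow_two, hw2, one_zpow, zpow_one, one_mul]
  have hneg : ∀ v ∈ mv cs' Q0, rho cs' w v = - v := by
    have : mv cs' Q0 ≤ LinearMap.ker (rho cs' w + 1) := by
      apply mv_le
      intro q hq v
      rw [LinearMap.mem_ker]
      rcases hQ0cases q hq with rfl | rfl
      · simp
      · rw [LinearMap.add_apply, map_sub, ← rho_mul, hw2, rho_one]; simp
    intro v hv
    have := this hv
    rw [LinearMap.mem_ker, LinearMap.add_apply, Module.End.one_apply] at this
    exact eq_neg_of_add_eq_zero_left this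
  obtain ⟨g, J, hJ, hPJ, hg, heq⟩ := exists_std (cs := cs') hQ0fin
  obtain ⟨P, hPfin, hP⟩ := exists_closure (cs := cs') hQ0fin
  have hcent : ∀ x, (∀ v, rho cs' x v - v ∈ mv cs' Q0) → x * w = w * x := by
    intro x hx
    have hx' : g⁻¹ * x * g ∈ par cs' J := by
      apply mem_par_of_sub
      intro v
      have h1 := hx (rho cs' g v)
      rw [heq] at h1
      obtain ⟨y, hy, hy2⟩ := h1
      have : rho cs' (g⁻¹ * x * g) v - v = y := by
        apply rho_inj cs' g
        rw [hy2, map_sub, ← rho_mul, ← rho_mul]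
        group
      rw [this]; exact hy
    have hle : par cs' J ≤ Subgroup.centralizer {g⁻¹ * w * g} := by
      rw [par, Subgroup.closure_le]
      rintro _ ⟨j, hj, rfl⟩
      rw [SetLike.mem_coe, Subgroup.mem_centralizer_singleton_iff]
      apply Eq.symm
      apply comm_simple (e := -1) (Or.inr rfl)
      have : rho cs' g (al j) ∈ mv cs' Q0 := by rw [heq]; exact ⟨_, al_mem_VV hj, rfl⟩
      rw [rho_mul, rho_mul, hneg _ this, map_neg, rho_inv_rho]; simp
    have := Subgroup.mem_centralizer_singleton_iff.1 (hle hx')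
    calc x * w = g * ((g⁻¹ * x * g) * (g⁻¹ * w * g)) * g⁻¹ := by group
      _ = g * ((g⁻¹ * w * g) * (g⁻¹ * x * g)) * g⁻¹ := by rw [this]
      _ = _ := by group
  refine ⟨P.comap f.toMonoidHom, ?_, ?_, ?_, ?_, ?_, hnr, ?_⟩
  · rw [Subgroup.mem_comap, hP]; intro v; exact sub_mem_mv hwQ v
  · intro q hq
    rw [Subgroup.mem_comap, hP] at hq
    apply f.injective
    rw [map_mul, map_mul]
    exact hcent _ hq
  · intro c hc q hq
    rw [Subgroup.mem_comap, hP] at hq ⊢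
    have hcw : f c * w = w * f c := by rw [hw, ← map_mul, hc, map_mul]
    have hpres : mv cs' Q0 ≤ (mv cs' Q0).comap (rho cs' (f c)) := by
      apply mv_le
      intro q hq v
      rw [Submodule.mem_comap, map_sub, ← rho_mul]
      have : f c * q = q * f c := by
        rcases hQ0cases q hq with rfl | rfl
        · simp
        · exact hcw
      rw [this, rho_mul]
      exact sub_mem_mv hq _
    intro v
    have := hpres (hq (rho cs' (f c)⁻¹ v))
    rw [Submodule.mem_comap, map_sub, rho_rho_inv] at this
    simpa using this
  · intro H hH hiH
    have hH' : ((H.map f.toMonoidHom : Subgroup W') : Set W').Finite := by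
      rw [Subgroup.coe_map]; exact hH.image _
    obtain ⟨P', hP'fin, hP'⟩ := exists_closure (cs := cs') hH'
    have hle : H ⊔ P.comap f.toMonoidHom ≤ P'.comap f.toMonoidHom := by
      apply sup_le
      · intro x hx
        rw [Subgroup.mem_comap, hP']
        intro v
        exact sub_mem_mv (Subgroup.mem_map_of_mem _ hx) v
      · intro x hx
        rw [Subgroup.mem_comap, hP] at hx
        rw [Subgroup.mem_comap, hP']
        intro v
        refine mv_mono ?_ (hx v)
        rw [hQ0, Subgroup.zpowers_le]
        exact ⟨_, hiH, rfl⟩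
    refine Set.Finite.subset ?_ hle
    rw [Subgroup.coe_comap]
    exact hP'fin.preimage f.injective.injOn
  · have hw0 := hg w hwQ
    have hw01 : g⁻¹ * w * g ≠ 1 := by
      intro h
      apply hw1
      have : w = g * (g⁻¹ * w * g) * g⁻¹ := by group
      rw [this, h]; group
    obtain ⟨j, hj, hl, _⟩ := exists_descent hw0 hw01
    have hne : g⁻¹ * w * g * cs'.simple j ≠ 1 := by
      intro h
      apply hnr
      refine ⟨g, j, ?_⟩
      have : cs'.simple j = g⁻¹ * w * g := by
        have := mul_eq_one_iff_eq_inv.1 h; simpa using this.symm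
      rw [this]; group
    obtain ⟨k, hk, hl2, _⟩ := exists_descent (mul_mem hw0 (simple_mem_par hj)) hne
    have hjk : j ≠ k := by
      rintro rfl
      simp at hl2; omega
    have hmem : ∀ l ∈ J, f.symm (g * cs'.simple l * g⁻¹) ∈ P.comap f.toMonoidHom := by
      intro l hl
      rw [Subgroup.mem_comap, hP]
      intro v
      have : f.toMonoidHom (f.symm (g * cs'.simple l * g⁻¹)) = g * cs'.simple l * g⁻¹ := by simp
      rw [this, heq]
      refine ⟨_, par_sub (simple_mem_par (cs := cs') hl) (rho cs' g⁻¹ v), ?_⟩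
      simp
    have hR : ∀ l, cs'.IsReflection (f (f.symm (g * cs'.simple l * g⁻¹))) := by
      intro l
      rw [MulEquiv.apply_symm_apply]; exact ⟨g, l, rfl⟩
    have hn1 : ∀ l, f.symm (g * cs'.simple l * g⁻¹) ≠ 1 := by
      intro l hl
      have := hR l
      rw [hl, map_one] at this
      have := this.odd_length
      simp at this
    have hns : ∀ l, f.symm (g * cs'.simple l * g⁻¹) ≠ cs.simple i := by
      intro l hl
      have := hR l
      rw [hl] at this
      exact hnr this
    refine ⟨_, hmem j hj, _, hmem k hk, ?_, hn1 _, hn1 _, hns _, hns _, hR _, hR _⟩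
    intro h
    have := f.symm.injective h
    apply hjk
    exact simple_inj (cs := cs') (by simpa using this)
  · intro x y hx
    simp only [map_mul, map_inv]
    exact hx.conj _

end CoxRefl

namespace CoxRefl

open CoxeterSystem

variable {B W : Type*} [Group W] {M : CoxeterMatrix B} {cs : CoxeterSystem M W}

/-- support of a subspace -/
def supp (L : Submodule ℝ (B →₀ ℝ)) : Set B := {k | ∃ v ∈ L, v k ≠ 0}

theorem le_VV_supp {L : Submodule ℝ (B →₀ ℝ)} : L ≤ VV (supp L) := by
  intro v hv
  rw [mem_VV]
  intro k hk
  by_contra h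
  exact hk ⟨v, hv, h⟩

theorem supp_subset {L : Submodule ℝ (B →₀ ℝ)} {J : Set B} (h : L ≤ VV J) : supp L ⊆ J := by
  rintro k ⟨v, hv, hk⟩
  by_contra hn
  exact hk (mem_VV.1 (h hv) k hn)

theorem apply_eq_zero {L : Submodule ℝ (B →₀ ℝ)} {v : B →₀ ℝ} (hv : v ∈ L) {k : B}
    (hk : k ∉ supp L) : v k = 0 := mem_VV.1 (le_VV_supp hv) k hk

theorem mv_cj (u : W) (Q : Subgroup W) : mv cs (cj u Q) = (mv cs Q).map (rho cs u) := by
  apply le_antisymm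
  · apply mv_le
    intro q hq v
    rw [mem_cj] at hq
    refine ⟨_, sub_mem_mv hq (rho cs u⁻¹ v), ?_⟩
    rw [map_sub, rho_rho_inv, ← rho_mul, ← rho_mul]; group
  · rw [Submodule.map_le_iff_le_comap]
    apply mv_le
    intro q hq v
    rw [Submodule.mem_comap]
    have h : u * q * u⁻¹ ∈ cj u Q := by rw [mem_cj]; convert hq using 1; group
    have := sub_mem_mv (cs := cs) h (rho cs u v)
    rw [map_sub]
    convert this using 2
    rw [← rho_mul, ← rho_mul]; group

/-- sums of nonneg vectors against a simple root -/
theorem bf_nonpos {v : B →₀ ℝ} (hv : 0 ≤ v) {j : B} (hj : v j = 0) : bf M v (al j) ≤ 0 := by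
  rw [bf_symm]
  have h := fun_nonneg (J := {j}ᶜ) (x := - bf M (al j)) (fun k hk => by
    have := bf_al_nonpos (M := M) (i := j) (j := k) (fun h => hk (by simp [h]))
    simpa using this) hv (mem_VV.2 (fun k hk => by
      have : k = j := by simpa using hk
      rw [this, hj]))
  simpa using h

theorem bf_neg {v : B →₀ ℝ} (hv : 0 ≤ v) {j k : B} (hj : v j = 0) (hk : 0 < v k)
    (hjk : bf M (al k) (al j) < 0) : bf M v (al j) < 0 := by
  have h1 : 0 ≤ v - v k • al k := by
    intro l
    by_cases h : l = k
    · subst h; simp [al]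
    · have := hv l
      simp [al, Ne.symm h] at this ⊢; exact this
  have hne : k ≠ j := by rintro rfl; linarith
  have h2 := bf_nonpos (M := M) h1 (j := j) (by simp [al, hj, hne])
  rw [map_sub, map_smul, LinearMap.sub_apply, LinearMap.smul_apply, smul_eq_mul] at h2
  nlinarith

theorem bf_al_neg {i j : B} (h : i ≠ j) (h2 : M i j ≠ 2) (h0 : M i j ≠ 0) :
    bf M (al i) (al j) ≤ - (1 / 2) := by
  have h1 : M i j ≠ 1 := by
    intro h'; exact M.off_diagonal i j h h'
  have := bf_al_le_of_ge (M := M) (i := i) (j := j) (n := 3) (by norm_num) (by omega)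
  simpa using this

theorem bf_al_two {i j : B} (h2 : M i j = 2) : bf M (al i) (al j) = 0 := by
  rw [bf_al, h2]; simp

section
variable {R : W → Prop} {i : B} {Q : Subgroup W}

theorem Bad.fin (hb : Bad cs R i Q) : (Q : Set W).Finite := by
  have h1 : (Subgroup.zpowers (cs.simple i) : Set W).Finite := by
    have : IsOfFinOrder (cs.simple i) :=
      isOfFinOrder_iff_pow_eq_one.2 ⟨2, by norm_num, by simp⟩
    exact this.finite_zpowers
  exact (hb.sup _ h1 (Subgroup.mem_zpowers _)).subset (SetLike.coe_subset_coe.2 le_sup_right)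

theorem Bad.al_mem (hb : Bad cs R i Q) : al i ∈ mv cs Q := by
  have := sub_mem_mv (cs := cs) hb.mem (al i)
  rw [rho_simple_self] at this
  have h2 : (-al i - al i : B →₀ ℝ) = (-2 : ℝ) • al i := by module
  rw [h2] at this
  exact (Submodule.smul_mem_iff _ (by norm_num)).1 this

theorem Bad.mem_supp (hb : Bad cs R i Q) : i ∈ supp (mv cs Q) := ⟨_, hb.al_mem, by simp [al]⟩

theorem Bad.pres (hb : Bad cs R i Q) {c : W} (hc : c * cs.simple i = cs.simple i * c) {v : B →₀ ℝ} (hv : v ∈ mv cs Q) :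
    rho cs c v ∈ mv cs Q := by
  have : mv cs Q ≤ (mv cs Q).comap (rho cs c) := by
    apply mv_le
    intro q hq v
    rw [Submodule.mem_comap, map_sub]
    have := sub_mem_mv (cs := cs) (hb.norm c hc q hq) (rho cs c v)
    convert this using 2
    rw [← rho_mul, ← rho_mul]; group
  exact this hv

theorem Bad.pres_al (hb : Bad cs R i Q) {k : B} (hc : M i k = 2) {v : B →₀ ℝ} (hv : v ∈ mv cs Q)
    (hne : bf M v (al k) ≠ 0) : al k ∈ mv cs Q := by
  have hcomm : cs.simple k * cs.simple i = cs.simple i * cs.simple k := by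
    apply comm_simple (e := 1) (Or.inl rfl)
    rw [rho_simple, sg_apply, bf_symm, bf_al_two hc]; simp
  have h1 := sub_mem (hb.pres hcomm hv) hv
  rw [rho_simple, sg_apply, sub_sub_cancel_left, ← neg_smul] at h1
  refine (Submodule.smul_mem_iff _ ?_).1 h1
  rw [bf_symm]
  simpa using hne

theorem Bad.struct (hb : Bad cs R i Q) : (supp (mv cs Q)).Finite ∧ FiniteDimensional ℝ (mv cs Q) ∧
    (∀ v ∈ mv cs Q, v ≠ 0 → 0 < bf M v v) ∧
    mv cs Q ≤ Submodule.span ℝ {b | IsRoot cs b ∧ b ∈ mv cs Q} := by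
  obtain ⟨g, J, hJ, hP, hg, heq⟩ := exists_std (cs := cs) hb.fin
  have hspan : mv cs Q = Submodule.span ℝ ((rho cs g ∘ al) '' J) := by
    rw [heq, VV_eq_span, Submodule.map_span, Set.image_comp]
  have hfd : FiniteDimensional ℝ (mv cs Q) := by
    rw [hspan]; exact FiniteDimensional.span_of_finite ℝ (hJ.image _)
  refine ⟨?_, hfd, ?_, ?_⟩
  · have hfin : (⋃ j ∈ J, ((rho cs g (al j)).support : Set B)).Finite :=
      hJ.biUnion (fun j _ => Finset.finite_toSet _)
    refine hfin.subset ?_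
    apply supp_subset
    rw [hspan, Submodule.span_le]
    rintro _ ⟨j, hj, rfl⟩
    rw [SetLike.mem_coe, mem_VV]
    intro k hk
    by_contra h
    exact hk (Set.mem_biUnion hj (by simpa using h))
  · intro v hv h0
    rw [heq] at hv
    obtain ⟨y, hy, rfl⟩ := hv
    rw [bf_rho]
    exact posdef hJ hP hy (fun h => h0 (by simp [h]))
  · conv_lhs => rw [hspan]
    apply Submodule.span_mono
    rintro _ ⟨j, hj, rfl⟩
    refine ⟨(isRoot_al j).rho g, ?_⟩
    rw [heq]
    exact ⟨_, al_mem_VV hj, rfl⟩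

theorem Bad.exists_root (hb : Bad cs R i Q) : ∃ b, IsRoot cs b ∧ b ∈ mv cs Q ∧ 0 ≤ b ∧ b ≠ al i := by
  by_contra! hcon
  have hle : mv cs Q ≤ VV {i} := by
    refine hb.struct.2.2.2.trans ?_
    rw [Submodule.span_le]
    rintro b ⟨h1, h2⟩
    rcases h1.pos_or_neg with h3 | h3
    · rw [hcon b h1 h2 h3]; exact al_mem_VV rfl
    · have := hcon (-b) h1.neg (neg_mem h2) (by simpa using h3)
      rw [neg_eq_iff_eq_neg] at this
      rw [this]; exact neg_mem (al_mem_VV rfl)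
  obtain ⟨a, ha, -, -, -, h1, -, h2, -⟩ := hb.two
  rcases par_singleton (mem_par_of_sub (fun v => hle (sub_mem_mv ha v))) with h | h
  · exact h1 h
  · exact h2 h

/-- positive vectors generating the orthogonal complement of the simple root -/
theorem Bad.exists_N (hb : Bad cs R i Q) : ∃ N : Set (B →₀ ℝ), N.Nonempty ∧
    (∀ v ∈ N, v ∈ mv cs Q ∧ 0 ≤ v ∧ v ≠ 0 ∧ bf M v (al i) = 0) ∧
    ∀ v ∈ mv cs Q, bf M v (al i) = 0 → v ∈ Submodule.span ℝ N := by
  set N : Set (B →₀ ℝ) := {v | ∃ b, IsRoot cs b ∧ b ∈ mv cs Q ∧ 0 ≤ b ∧ b ≠ al i ∧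
    bf M b (al i) ≤ 0 ∧ v = b - bf M b (al i) • al i} with hN
  have hpos : ∀ b, IsRoot cs b → b ∈ mv cs Q → 0 ≤ b → b ≠ al i → b - bf M b (al i) • al i ∈ N := by
    intro b h1 h2 h3 h4
    by_cases h5 : bf M b (al i) ≤ 0
    · exact ⟨b, h1, h2, h3, h4, h5, rfl⟩
    · refine ⟨rho cs (cs.simple i) b, h1.rho _, hb.pres rfl h2, h1.simple_perm i h3 h4, ?_, ?_, ?_⟩
      · intro h
        have : b = - al i := by
          rw [← rho_simple_self cs i, ← h, ← rho_mul]; simp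
        rw [this] at h3
        have := h3 i
        simp [al] at this
        linarith
      · rw [bf_rho_left, cs.inv_simple, rho_simple_self, map_neg]; linarith
      · rw [bf_rho_left, cs.inv_simple, rho_simple_self, map_neg, rho_simple, sg_apply, bf_symm (al i) b]
        module
  refine ⟨N, ?_, ?_, ?_⟩
  · obtain ⟨b, h1, h2, h3, h4⟩ := hb.exists_root
    exact ⟨_, hpos b h1 h2 h3 h4⟩
  · rintro v ⟨b, h1, h2, h3, h4, h5, rfl⟩
    refine ⟨sub_mem h2 (Submodule.smul_mem _ _ hb.al_mem), ?_, ?_, ?_⟩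
    · rw [sub_eq_add_neg, ← neg_smul]
      exact add_nonneg h3 (smul_nn (by linarith) (al_nonneg i))
    · intro h
      exact h4 (h1.eq_of_smul i _ h3 (sub_eq_zero.1 h))
    · simp [bf_al_self]
  · intro v hv h0
    have key : mv cs Q ≤ (Submodule.span ℝ N).comap
        (LinearMap.id - (LinearMap.toSpanSingleton ℝ (B →₀ ℝ) (al i)) ∘ₗ (bf M (al i))) := by
      refine hb.struct.2.2.2.trans ?_
      rw [Submodule.span_le]
      rintro b ⟨h1, h2⟩
      simp only [SetLike.mem_coe, Submodule.mem_comap, LinearMap.sub_apply, LinearMap.id_apply,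
        LinearMap.comp_apply, LinearMap.toSpanSingleton_apply]
      rw [bf_symm]
      have hposs : ∀ b, IsRoot cs b → b ∈ mv cs Q → 0 ≤ b → b - bf M b (al i) • al i ∈ Submodule.span ℝ N := by
        intro b h1 h2 h3
        by_cases h4 : b = al i
        · rw [h4, bf_al_self]; simp
        · exact Submodule.subset_span (hpos b h1 h2 h3 h4)
      rcases h1.pos_or_neg with h3 | h3
      · exact hposs b h1 h2 h3
      · have := neg_mem (hposs (-b) h1.neg (neg_mem h2) (by simpa using h3))
        rw [map_neg, LinearMap.neg_apply] at this
        convert this using 1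
        module
    have := key hv
    simp only [Submodule.mem_comap, LinearMap.sub_apply, LinearMap.id_apply,
        LinearMap.comp_apply, LinearMap.toSpanSingleton_apply] at this
    rw [bf_symm, h0] at this
    simpa using this

end

/-- connectedness of a subset of the Coxeter graph -/
def ConnOn (M : CoxeterMatrix B) (J : Set B) : Prop :=
  ∀ A : Set B, A ⊆ J → A.Nonempty → (∀ a ∈ A, ∀ b ∈ J, b ≠ a → M a b ≠ 2 → b ∈ A) → A = J

section
variable {R : W → Prop} {i : B} {Q : Subgroup W}

theorem Bad.lemmaB (hb : Bad cs R i Q) (h0 : ∀ b b', M b b' ≠ 0) {J : Set B} (hJ : ConnOn M J) (hKJ : supp (mv cs Q) ⊂ J) :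
    ∃ j ∈ J, j ∉ supp (mv cs Q) ∧ ∃ v ∈ mv cs Q, bf M v (al i) = 0 ∧ bf M v (al j) ≠ 0 := by
  by_contra! hcon
  obtain ⟨N, hN0, hN, hspan⟩ := hb.exists_N
  have hKsub : {k | ∃ v ∈ N, v k ≠ 0} ⊆ supp (mv cs Q) := by
    rintro k ⟨v, hv, hk⟩; exact ⟨v, (hN v hv).1, hk⟩
  have := hJ {k | ∃ v ∈ N, v k ≠ 0} (hKsub.trans hKJ.1) ?_ ?_
  · exact hKJ.2 (this ▸ hKsub)
  · obtain ⟨v, hv⟩ := hN0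
    obtain ⟨k, hk⟩ := Finsupp.ne_iff.1 (hN v hv).2.2.1
    exact ⟨k, v, hv, hk⟩
  · rintro a ⟨v, hv, hva⟩ b hbJ hba hM
    obtain ⟨h1, h2, h3, h4⟩ := hN v hv
    have hneg : bf M (al a) (al b) < 0 :=
      lt_of_le_of_lt (bf_al_neg hba.symm hM (h0 a b)) (by norm_num)
    have hva' : 0 < v a := lt_of_le_of_ne (h2 a) (Ne.symm hva)
    by_cases hvb : v b = 0
    swap
    · exact ⟨v, hv, hvb⟩
    have hlt := bf_neg h2 hvb hva' hneg
    by_cases hbK : b ∈ supp (mv cs Q)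
    · have hbi : b ≠ i := by rintro rfl; linarith
      obtain ⟨x, hx, hxb⟩ := hbK
      by_contra hno
      have hle : Submodule.span ℝ N ≤ LinearMap.ker (Finsupp.lapply b : (B →₀ ℝ) →ₗ[ℝ] ℝ) := by
        rw [Submodule.span_le]
        intro y hy
        by_contra hyb
        exact hno ⟨y, hy, hyb⟩
      have := hle (hspan (x - bf M x (al i) • al i)
        (sub_mem hx (Submodule.smul_mem _ _ hb.al_mem)) (by simp [bf_al_self]))
      simp [al, hbi.symm] at this
      exact hxb this
    · have := hcon b hbJ hbK v h1 h4
      linarith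

theorem Bad.W1 (hb : Bad cs R i Q) {j : B} (hj : j ∉ supp (mv cs Q)) (h2 : M i j = 2) {v : B →₀ ℝ} (hv : v ∈ mv cs Q) :
    bf M v (al j) = 0 := by
  by_contra h
  exact hj ⟨_, hb.pres_al h2 hv h, by simp [al]⟩

theorem par_pair {i j : B} {w : W} (hw : w ∈ par cs {i, j}) (v : B →₀ ℝ) :
    ∃ x y : ℝ, rho cs w v = v + x • al i + y • al j := by
  have h := par_sub hw v
  rw [VV_eq_span, Set.image_pair, Submodule.mem_span_pair] at h
  obtain ⟨x, y, h⟩ := h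
  refine ⟨x, y, ?_⟩
  rw [add_assoc, h]; simp

theorem Bad.W2 (hb : Bad cs R i Q) {j : B} (hj : j ∉ supp (mv cs Q)) {k : ℕ} (hk : M i j = k + k) (h0 : M i j ≠ 0)
    {v : B →₀ ℝ} (hv : v ∈ mv cs Q) (hvi : bf M v (al i) = 0) : bf M v (al j) = 0 := by
  have hij : i ≠ j := by rintro rfl; exact hj hb.mem_supp
  set z := (cs.simple i * cs.simple j) ^ k with hz
  have hzrho : rho cs z = (sg M (al i) * sg M (al j)) ^ k := by
    rw [hz, map_pow, map_mul, rho_simple, rho_simple]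
  have hzm : z ∈ par cs {i, j} :=
    pow_mem (mul_mem (simple_mem_par (by simp)) (simple_mem_par (by simp))) k
  obtain ⟨e1, e2⟩ := sg_pow_al (M := M) i j k
  have hk2 : 2 * k = M i j := by omega
  rw [← hzrho, hk2, ps_M hij h0, ps_M_succ hij h0] at e1 e2
  have e1' : rho cs z (al i) = (-1 : ℝ) • al i := by rw [e1]; simp
  have e2' : rho cs z (al j) = - al j := by rw [e2]; simp
  have hc := comm_simple (Or.inr rfl) e1'
  obtain ⟨x, y, hxy⟩ := par_pair hzm v
  have hzL := hb.pres hc hv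
  have hy : y = 0 := by
    have h1 := apply_eq_zero hzL hj
    rw [hxy] at h1
    have h2 := apply_eq_zero hv hj
    simpa [al, hij, h2] using h1
  have hx : x = 0 := by
    have h1 := bf_rho cs z v (al i)
    rw [e1', hxy, hy] at h1
    simp [hvi, bf_al_self] at h1
    exact h1
  have h3 := bf_rho cs z v (al j)
  rw [hxy, hx, hy, e2'] at h3
  simp at h3
  linarith

/-- the growth step -/
theorem Bad.growth (hb : Bad cs R i Q) (h0 : ∀ b b', M b b' ≠ 0) {J : Set B} (hJ : ConnOn M J) (hKJ : supp (mv cs Q) ⊂ J) :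
    ∃ j ∈ J, ∃ u : W, j ∉ supp (mv cs Q) ∧ i ≠ j ∧ Odd (M i j) ∧ Bad cs R j (cj u Q) ∧
      supp (mv cs (cj u Q)) = insert j (supp (mv cs Q)) ∧
      ∀ v, bf M v (al i) = 0 → 
        ∃ x : ℝ, rho cs u v = v + x • (al i + al j) ∧ x * (cc M i j - 1) = bf M v (al j) := by
  obtain ⟨j, hjJ, hjK, v0, hv0, hv0i, hv0j⟩ := hb.lemmaB h0 hJ hKJ
  have hij : i ≠ j := by rintro rfl; exact hjK hb.mem_supp
  have hodd : Odd (M i j) := by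
    rw [← Nat.not_even_iff_odd]
    rintro ⟨k, hk⟩
    exact hv0j (hb.W2 hjK hk (h0 i j) hv0 hv0i)
  obtain ⟨k, hk⟩ := id hodd
  set u := (cs.simple i * cs.simple j) ^ k with hu
  have hurho : rho cs u = (sg M (al i) * sg M (al j)) ^ k := by
    rw [hu, map_pow, map_mul, rho_simple, rho_simple]
  have hum : u ∈ par cs {i, j} :=
    pow_mem (mul_mem (simple_mem_par (by simp)) (simple_mem_par (by simp))) k
  obtain ⟨e1, e2⟩ := sg_pow_al (M := M) i j k
  have hps : ps (cc M i j) (2 * k) = 1 := by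
    have h1 := ps_M_succ hij (h0 i j)
    have h2 := ps_M hij (h0 i j)
    rw [hk] at h1 h2
    have h3 : ps (cc M i j) (2 * k + 1 + 1) = 2 * cc M i j * ps (cc M i j) (2 * k + 1) - ps (cc M i j) (2 * k) := rfl
    rw [h1, h2] at h3
    linarith
  rw [← hurho, hps, ← hk, ps_M hij (h0 i j)] at e1 e2
  have e1' : rho cs u (al i) = (1 : ℝ) • al j := by rw [e1]; simp
  have e2' : rho cs u (al j) = - al i - (2 * cc M i j) • al j := by rw [e2]; simp
  set c := cc M i j with hc
  have hbij : bf M (al i) (al j) = - c := bf_cc i j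
  have hbji : bf M (al j) (al i) = - c := by rw [bf_symm]; exact hbij
  have hc0 : 0 ≤ c := by have := bf_al_nonpos (M := M) hij; linarith
  have hform : ∀ v, bf M v (al i) = 0 →
      ∃ x : ℝ, rho cs u v = v + x • (al i + al j) ∧ x * (c - 1) = bf M v (al j) := by
    intro v hv
    obtain ⟨x, y, hxy⟩ := par_pair hum v
    have h1 := bf_rho cs u v (al i)
    have h2 := bf_rho cs u v (al j)
    rw [e1', hxy] at h1
    rw [e2', hxy] at h2
    simp only [map_add, map_sub, map_neg, map_smul, LinearMap.add_apply, LinearMap.smul_apply,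
      smul_eq_mul, bf_al_self, hbij, hbji, hv, mul_one] at h1 h2
    have h3 : (c + 1) * (y - x) = 0 := by linear_combination h2 + (1 + 2 * c) * h1
    have h4 : y = x := by
      rcases mul_eq_zero.1 h3 with h | h <;> linarith
    refine ⟨x, ?_, ?_⟩
    · rw [hxy, h4]; module
    · rw [h4] at h1; linarith
  have hbad : Bad cs R j (cj u Q) := hb.conjQ (conj_simple' (Or.inl rfl) e1')
  refine ⟨j, hjJ, u, hjK, hij, hodd, hbad, ?_, ?_⟩
  · have hiK : i ∈ supp (mv cs (cj u Q)) := by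
      by_contra hi
      apply hv0j
      obtain ⟨N, hN0, hN, hspan⟩ := hb.exists_N
      have hle : Submodule.span ℝ N ≤ LinearMap.ker (bf M (al j)) := by
        rw [Submodule.span_le]
        intro v hv
        obtain ⟨h1, h2, h3, h4⟩ := hN v hv
        obtain ⟨x, hx1, hx2⟩ := hform v h4
        have hm : rho cs u v ∈ mv cs (cj u Q) := by rw [mv_cj]; exact ⟨v, h1, rfl⟩
        have h5 := apply_eq_zero hm hi
        rw [hx1] at h5
        have h6 := h2 i
        simp [al, hij.symm] at h5 h6
        have h7 := bf_nonpos (M := M) h2 (apply_eq_zero h1 hjK)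
        have hc1 : c < 1 := by
          rw [hc, cc]
          have hM2 : 2 ≤ M i j := by
            have := h0 i j
            have h' := M.off_diagonal i j hij
            omega
          have hM2' : (2 : ℝ) ≤ M i j := by exact_mod_cast hM2
          have := sin_pos_M hij (h0 i j)
          nlinarith [Real.sin_sq_add_cos_sq (Real.pi / M i j), Real.cos_le_one (Real.pi / M i j)]
        rw [SetLike.mem_coe, LinearMap.mem_ker, bf_symm]
        nlinarith
      have := hle (hspan v0 hv0 hv0i)
      rw [LinearMap.mem_ker, bf_symm] at this
      exact this
    apply Set.Subset.antisymm
    · apply supp_subset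
      rw [mv_cj]
      rintro _ ⟨v, hv, rfl⟩
      obtain ⟨x, y, hxy⟩ := par_pair hum v
      rw [hxy]
      refine add_mem (add_mem ?_ (Submodule.smul_mem _ _ (al_mem_VV ?_))) (Submodule.smul_mem _ _ (al_mem_VV ?_))
      · exact Finsupp.supported_mono (Set.subset_insert _ _) (le_VV_supp hv)
      · exact Set.mem_insert_of_mem _ hb.mem_supp
      · exact Set.mem_insert _ _
    · intro l hl
      by_cases hlj : l = j
      · rw [hlj]; exact hbad.mem_supp
      by_cases hli : l = i
      · rw [hli]; exact hiK
      obtain ⟨v, hv, hvl⟩ := hl.resolve_left hlj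
      refine ⟨rho cs u v, by rw [mv_cj]; exact ⟨v, hv, rfl⟩, ?_⟩
      obtain ⟨x, y, hxy⟩ := par_pair hum v
      rw [hxy]
      simpa [al, Ne.symm hlj, Ne.symm hli] using hvl
  · intro v hv
    exact hform v hv

end

end CoxRefl

namespace CoxRefl

open CoxeterSystem

variable {B W : Type*} [Group W] {M : CoxeterMatrix B} {cs : CoxeterSystem M W}

/-- The Coxeter graph -/
abbrev cg (M : CoxeterMatrix B) : SimpleGraph B := SimpleGraph.fromRel fun b b' : B => M b b' ≠ 2

theorem cg_adj {a b : B} : (cg M).Adj a b ↔ a ≠ b ∧ M a b ≠ 2 := by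
  rw [SimpleGraph.fromRel_adj, M.symmetric b a, or_self]

theorem walk_closed {A J : Set B} (hA : ∀ a ∈ A, ∀ b ∈ J, b ≠ a → M a b ≠ 2 → b ∈ A) {x y : B}
    (p : (cg M).Walk x y) (hp : ∀ z ∈ p.support, z ∈ J) :
    (x ∈ A → ∀ z ∈ p.support, z ∈ A) ∧ (∀ z ∈ p.support, z ∈ A → x ∈ A) := by
  induction p with
  | nil => simp
  | @cons a b c hadj p ih =>
    have hp' : ∀ z ∈ p.support, z ∈ J := fun z hz => hp z (by simp [hz])
    obtain ⟨h1, h2⟩ := ih hp'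
    obtain ⟨hne, hM⟩ := cg_adj.1 hadj
    constructor
    · intro ha z hz
      rw [SimpleGraph.Walk.support_cons, List.mem_cons] at hz
      rcases hz with rfl | hz
      · exact ha
      · exact h1 (hA a ha b (hp' b (by simp)) hne.symm hM) z hz
    · intro z hz hzA
      rw [SimpleGraph.Walk.support_cons, List.mem_cons] at hz
      rcases hz with rfl | hz
      · exact hzA
      · exact hA b (h2 z hz hzA) a (hp a (by simp)) hne (by rw [M.symmetric]; exact hM)

theorem connOn_univ (h : (cg M).Connected) : ConnOn M Set.univ := by
  intro A _ hne hA
  obtain ⟨a, ha⟩ := hne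
  rw [Set.eq_univ_iff_forall]
  intro b
  obtain ⟨p⟩ := h.preconnected a b
  exact (walk_closed hA p (by simp)).1 ha b (by simp)

theorem exists_conn (h : (cg M).Connected) {F : Set B} (hF : F.Finite) :
    ∃ J : Set B, J.Finite ∧ F ⊆ J ∧ ConnOn M J := by
  obtain ⟨o⟩ := h.nonempty
  have hw : ∀ b, Nonempty ((cg M).Walk o b) := fun b => h.preconnected o b
  let q : ∀ b, (cg M).Walk o b := fun b => (hw b).some
  refine ⟨⋃ b ∈ F, {z | z ∈ (q b).support}, ?_, ?_, ?_⟩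
  · exact hF.biUnion (fun b _ => List.finite_toSet _)
  · intro b hb
    exact Set.mem_biUnion hb (by simp)
  · intro A hAJ hne hA
    apply Set.Subset.antisymm hAJ
    obtain ⟨a, ha⟩ := hne
    have hsub : ∀ b ∈ F, ∀ z ∈ (q b).support, z ∈ ⋃ b ∈ F, {z | z ∈ (q b).support} :=
      fun b hb z hz => Set.mem_biUnion hb hz
    have ho : o ∈ A := by
      obtain ⟨b, hb, hab⟩ := Set.mem_iUnion₂.1 (hAJ ha)
      exact (walk_closed hA (q b) (hsub b hb)).2 a hab ha
    intro z hz
    obtain ⟨b, hb, hzb⟩ := Set.mem_iUnion₂.1 hz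
    exact (walk_closed hA (q b) (hsub b hb)).1 ho z hzb

theorem par_singleton_finite (i : B) : (par cs {i} : Set W).Finite :=
  (Set.toFinite {1, cs.simple i}).subset (fun _ hw => by
    rcases par_singleton hw with h | h <;> simp [h])

theorem Bad.exists_pos_root {R : W → Prop} {i : B} {Q : Subgroup W} (hb : Bad cs R i Q) {k : B}
    (hk : k ∈ supp (mv cs Q)) : ∃ b, IsRoot cs b ∧ b ∈ mv cs Q ∧ 0 ≤ b ∧ 0 < b k := by
  by_contra! hcon
  have hle : mv cs Q ≤ LinearMap.ker (Finsupp.lapply k : (B →₀ ℝ) →ₗ[ℝ] ℝ) := by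
    refine hb.struct.2.2.2.trans ?_
    rw [Submodule.span_le]
    rintro b ⟨h1, h2⟩
    rw [SetLike.mem_coe, LinearMap.mem_ker, Finsupp.lapply_apply]
    rcases h1.pos_or_neg with h3 | h3
    · exact le_antisymm (hcon b h1 h2 h3) (h3 k)
    · have := hcon (-b) h1.neg (neg_mem h2) (by simpa using h3)
      have h4 := h3 k
      simp at this h4
      exact le_antisymm h4 this
  obtain ⟨v, hv, hvk⟩ := hk
  exact hvk (hle hv)

theorem Bad.lemmaS {R : W → Prop} {j : B} {Q : Subgroup W} (hb : Bad cs R j Q) {J : Set B}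
    (hJ : J.Finite) (hinf : ¬ (par cs J : Set W).Finite) (hKJ : supp (mv cs Q) ⊆ J) :
    supp (mv cs Q) ≠ J := by
  intro heq
  have hjJ : j ∈ J := hKJ hb.mem_supp
  have hfin : {K0 : Set B | K0 ⊆ J ∧ j ∈ K0 ∧ (par cs K0 : Set W).Finite}.Finite :=
    hJ.finite_subsets.subset (fun K h => h.1)
  obtain ⟨K0, hmax⟩ := hfin.exists_maximal ⟨{j}, by simpa using hjJ, rfl, par_singleton_finite j⟩
  obtain ⟨⟨hK0J, hjK0, hK0fin⟩, hmax⟩ := hmax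
  obtain ⟨x, hx1, hx2⟩ := exists_fixed (cs := cs) (hb.sup _ hK0fin (simple_mem_par hjK0))
  have hxK0 : ∀ k ∈ K0, x (al k) = 0 := by
    intro k hk
    have := hx1 _ (Subgroup.mem_sup_left (simple_mem_par hk)) (al k)
    rw [rho_simple_self, map_neg] at this
    linarith
  have hxpos : ∀ k ∈ J, k ∉ K0 → 0 < x (al k) := by
    intro k hk hkK
    by_contra! hneg
    have hf : (par cs (insert k K0) : Set W).Finite := by
      apply par_finite_of_pos (hJ.subset (Set.insert_subset hk hK0J))
      refine hx2.subset ?_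
      rintro b ⟨h1, h2, h3⟩
      refine ⟨h1, h2, ?_⟩
      have := fun_nonneg (x := -x) (J := insert k K0) (fun l hl => by
        rcases hl with rfl | hl
        · simpa using hneg
        · simp [hxK0 l hl]) h2 h3
      simpa using this
    have := hmax ⟨Set.insert_subset hk hK0J, Set.mem_insert_of_mem _ hjK0, hf⟩ (Set.subset_insert k K0)
    exact hkK (this (Set.mem_insert _ _))
  have hne : ∃ k ∈ J, k ∉ K0 := by
    by_contra! hcon
    exact hinf (Set.Subset.antisymm hK0J hcon ▸ hK0fin)
  obtain ⟨k, hkJ, hkK⟩ := hne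
  obtain ⟨b, h1, h2, h3, h4⟩ := hb.exists_pos_root (heq ▸ hkJ)
  have hx0 : x b = 0 := by
    have : mv cs Q ≤ LinearMap.ker x := by
      apply mv_le
      intro q hq v
      rw [LinearMap.mem_ker, map_sub, hx1 q (Subgroup.mem_sup_right hq), sub_self]
    exact this h2
  have hxJ : ∀ l ∈ J, 0 ≤ x (al l) := by
    intro l hl
    by_cases h : l ∈ K0
    · rw [hxK0 l h]
    · exact (hxpos l hl h).le
  have h5 : 0 ≤ b - b k • al k := by
    intro l
    by_cases h : l = k
    · subst h; simp [al]
    · have := h3 l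
      simp [al, Ne.symm h] at this ⊢; exact this
  have h6 := fun_nonneg hxJ h5 (sub_mem (Finsupp.supported_mono hKJ (le_VV_supp h2))
    (Submodule.smul_mem _ _ (al_mem_VV hkJ)))
  rw [map_sub, map_smul, hx0, smul_eq_mul] at h6
  have := mul_pos h4 (hxpos k hkJ hkK)
  linarith

theorem caseI {R : W → Prop} {i : B} {Q : Subgroup W} (hb : Bad cs R i Q)
    (h0 : ∀ b b', M b b' ≠ 0) {J : Set B}
    (hJ : J.Finite) (hconn : ConnOn M J) (hinf : ¬ (par cs J : Set W).Finite)
    (hKJ : supp (mv cs Q) ⊆ J) : False := by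
  induction hn : J.ncard - (supp (mv cs Q)).ncard using Nat.strong_induction_on generalizing i Q with
  | _ n IH =>
  have hss : supp (mv cs Q) ⊂ J := lt_of_le_of_ne hKJ (hb.lemmaS hJ hinf hKJ)
  obtain ⟨j, hj, u, hjK, _, _, hbad, hs, _⟩ := hb.growth h0 hconn hss
  have h1 := Set.ncard_lt_ncard hss hJ
  refine IH _ ?_ hbad (by rw [hs]; exact Set.insert_subset hj hKJ) rfl
  rw [hs, Set.ncard_insert_of_notMem hjK (hJ.subset hKJ)]
  omega

end CoxRefl

namespace CoxRefl

open CoxeterSystem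

variable {B W : Type*} [Group W] {M : CoxeterMatrix B} {cs : CoxeterSystem M W}

/-- infinite chain of growth steps -/
structure Chain (cs : CoxeterSystem M W) (R : W → Prop) where
  /-- vertices -/
  i : ℕ → B
  /-- subgroups -/
  Q : ℕ → Subgroup W
  /-- conjugators -/
  u : ℕ → W
  bad : ∀ n, Bad cs R (i n) (Q n)
  hQ : ∀ n, Q (n + 1) = cj (u n) (Q n)
  hnot : ∀ n, i (n + 1) ∉ supp (mv cs (Q n))
  hsupp : ∀ n, supp (mv cs (Q (n + 1))) = insert (i (n + 1)) (supp (mv cs (Q n)))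
  hne : ∀ n, i n ≠ i (n + 1)
  hodd : ∀ n, Odd (M (i n) (i (n + 1)))
  hform : ∀ n, ∀ v, bf M v (al (i n)) = 0 → ∃ x : ℝ,
    rho cs (u n) v = v + x • (al (i n) + al (i (n + 1))) ∧
      x * (cc M (i n) (i (n + 1)) - 1) = bf M v (al (i (n + 1)))
  h0 : ∀ b b', M b b' ≠ 0
  conn : ConnOn M Set.univ
  pd : ∀ v : B →₀ ℝ, v ≠ 0 → 0 < bf M v v
  inf : Infinite B

theorem exists_chain {R : W → Prop} {i : B} {Q : Subgroup W} (hb : Bad cs R i Q)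
    (h0 : ∀ b b', M b b' ≠ 0) (conn : ConnOn M Set.univ)
    (pd : ∀ v : B →₀ ℝ, v ≠ 0 → 0 < bf M v v) (inf : Infinite B) : Nonempty (Chain cs R) := by
  have step : ∀ t : {p : B × Subgroup W // Bad cs R p.1 p.2}, ∃ t' : {p : B × Subgroup W // Bad cs R p.1 p.2},
      ∃ u : W, t'.1.2 = cj u t.1.2 ∧ t'.1.1 ∉ supp (mv cs t.1.2) ∧
      supp (mv cs t'.1.2) = insert t'.1.1 (supp (mv cs t.1.2)) ∧ t.1.1 ≠ t'.1.1 ∧ Odd (M t.1.1 t'.1.1) ∧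
      ∀ v, bf M v (al t.1.1) = 0 → ∃ x : ℝ,
        rho cs u v = v + x • (al t.1.1 + al t'.1.1) ∧
        x * (cc M t.1.1 t'.1.1 - 1) = bf M v (al t'.1.1) := by
    rintro ⟨⟨i, Q⟩, hb⟩
    have hss : supp (mv cs Q) ⊂ Set.univ := by
      rw [Set.ssubset_univ_iff]
      intro h
      exact Set.infinite_univ (h ▸ hb.struct.1)
    obtain ⟨j, -, u, h1, h2, h3, h4, h5, h6⟩ := hb.growth h0 conn hss
    exact ⟨⟨⟨j, cj u Q⟩, h4⟩, u, rfl, h1, h5, h2, h3, h6⟩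
  choose nx u h1 h2 h3 h4 h5 h6 using step
  let t : ℕ → {p : B × Subgroup W // Bad cs R p.1 p.2} := fun n => Nat.rec ⟨⟨i, Q⟩, hb⟩ (fun _ x => nx x) n
  exact ⟨⟨fun n => (t n).1.1, fun n => (t n).1.2, fun n => u (t n), fun n => (t n).2, fun n => h1 _,
    fun n => h2 _, fun n => h3 _, fun n => h4 _, fun n => h5 _, fun n => h6 _, h0, conn, pd, inf⟩⟩

namespace Chain

variable {R : W → Prop} (C : Chain cs R)

/-- subspace -/
noncomputable abbrev L (n : ℕ) : Submodule ℝ (B →₀ ℝ) := mv cs (C.Q n)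
/-- support -/
abbrev K (n : ℕ) : Set B := supp (C.L n)
/-- simple root -/
noncomputable abbrev a (n : ℕ) : B →₀ ℝ := al (C.i n)

theorem L_succ (n : ℕ) : C.L (n + 1) = (C.L n).map (rho cs (C.u n)) := by
  rw [L, C.hQ, mv_cj]

theorem mem_K (n : ℕ) : C.i n ∈ C.K n := (C.bad n).mem_supp

theorem K_succ (n : ℕ) : C.K (n + 1) = insert (C.i (n + 1)) (C.K n) := C.hsupp n

theorem K_mono {m n : ℕ} (h : m ≤ n) : C.K m ⊆ C.K n := by
  induction n, h using Nat.le_induction with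
  | base => exact subset_rfl
  | succ n _ ih => rw [C.K_succ]; exact ih.trans (Set.subset_insert _ _)

theorem i_inj {m n : ℕ} (h : m < n) : C.i m ≠ C.i n := by
  obtain ⟨n, rfl⟩ : ∃ k, n = k + 1 := ⟨n - 1, by omega⟩
  intro he
  exact C.hnot n (he ▸ C.K_mono (by omega) (C.mem_K m))

theorem i_injective : Function.Injective C.i := by
  intro m n h
  rcases lt_trichotomy m n with h' | h' | h'
  · exact absurd h (C.i_inj h')
  · exact h'
  · exact absurd h.symm (C.i_inj h')

theorem adj (n : ℕ) : M (C.i n) (C.i (n + 1)) ≠ 2 := by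
  intro h
  have := C.hodd n
  rw [h] at this
  exact absurd this (by decide)

theorem no_triangle {cs : CoxeterSystem M W} {R : W → Prop} (C : Chain cs R) {x y z : B} (hxy : x ≠ y) (hyz : y ≠ z) (hxz : x ≠ z)
    (h1 : M x y ≠ 2) (h2 : M y z ≠ 2) (h3 : M x z ≠ 2) : False := by
  have e1 := bf_al_neg hxy h1 (C.h0 _ _)
  have e2 := bf_al_neg hyz h2 (C.h0 _ _)
  have e3 := bf_al_neg hxz h3 (C.h0 _ _)
  have := C.pd (al x + al y + al z) (by
    intro h
    have := congrArg (fun v => v x) h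
    simp [al, hxy.symm, hxz.symm] at this)
  simp only [map_add, LinearMap.add_apply, bf_al_self, bf_symm (al y) (al x), bf_symm (al z) (al x),
    bf_symm (al z) (al y)] at this
  linarith

theorem bf_a (m n : ℕ) (h : m ≠ n) : bf M (C.a m) (C.a n) ≤ 0 :=
  bf_al_nonpos (fun he => h (C.i_injective he))

theorem M_eq (n : ℕ) : M (C.i n) (C.i (n + 1)) = 3 := by
  by_contra hne3
  have h2 := C.adj n
  have h0 := C.h0 (C.i n) (C.i (n + 1))
  have h1 := M.off_diagonal _ _ (C.hne n)
  have h5 : 5 ≤ M (C.i n) (C.i (n + 1)) := by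
    obtain ⟨k, hk⟩ := C.hodd n
    omega
  have e0 := bf_al_le_of_ge (M := M) (i := C.i n) (j := C.i (n + 1)) (n := 5) (by norm_num) h5
  have hc2 : (0.809 : ℝ) ≤ Real.cos (Real.pi / ((5 : ℕ) : ℝ)) := by
    have : Real.cos (Real.pi / ((5 : ℕ) : ℝ)) = (1 + √5) / 4 := by
      push_cast; exact Real.cos_pi_div_five
    rw [this]
    have : (2.236 : ℝ) ≤ √5 := Real.le_sqrt_of_sq_le (by norm_num)
    linarith
  have e1 := bf_al_neg (C.hne (n + 1)) (C.adj (n + 1)) (C.h0 _ _)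
  have e2 := bf_al_neg (C.hne (n + 2)) (C.adj (n + 2)) (C.h0 _ _)
  have e3 := bf_al_neg (C.hne (n + 3)) (C.adj (n + 3)) (C.h0 _ _)
  have f1 := C.bf_a n (n + 2) (by omega)
  have f2 := C.bf_a n (n + 3) (by omega)
  have f3 := C.bf_a n (n + 4) (by omega)
  have f4 := C.bf_a (n + 1) (n + 3) (by omega)
  have f5 := C.bf_a (n + 1) (n + 4) (by omega)
  have f6 := C.bf_a (n + 2) (n + 4) (by omega)
  have := C.pd ((0.8 : ℝ) • C.a n + (1 : ℝ) • C.a (n + 1) + (0.75 : ℝ) • C.a (n + 2) +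
    (0.5 : ℝ) • C.a (n + 3) + (0.25 : ℝ) • C.a (n + 4)) (by
      intro h
      have := congrArg (fun v => v (C.i n)) h
      simp [al, (C.i_inj (show n < n + 1 by omega)).symm, (C.i_inj (show n < n + 2 by omega)).symm,
        (C.i_inj (show n < n + 3 by omega)).symm, (C.i_inj (show n < n + 4 by omega)).symm] at this
      norm_num at this)
  simp only [map_add, map_smul, LinearMap.add_apply, LinearMap.smul_apply, smul_eq_mul, bf_al_self,
    bf_symm (C.a (n + 1)) (C.a n), bf_symm (C.a (n + 2)) (C.a n), bf_symm (C.a (n + 3)) (C.a n),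
    bf_symm (C.a (n + 4)) (C.a n), bf_symm (C.a (n + 2)) (C.a (n + 1)),
    bf_symm (C.a (n + 3)) (C.a (n + 1)), bf_symm (C.a (n + 4)) (C.a (n + 1)),
    bf_symm (C.a (n + 3)) (C.a (n + 2)), bf_symm (C.a (n + 4)) (C.a (n + 2)),
    bf_symm (C.a (n + 4)) (C.a (n + 3))] at this
  linarith

theorem T1 {n : ℕ} {j k : B} (hj : j ∉ C.K n) (hk : k ∈ C.K n) (hjk : M k j ≠ 2) :
    M (C.i n) j ≠ 2 := by
  intro h2
  obtain ⟨b, h1, h3, h4, h5⟩ := (C.bad n).exists_pos_root hk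
  have hkj : k ≠ j := by rintro rfl; exact hj hk
  have h6 := bf_neg (M := M) h4 (apply_eq_zero h3 hj) h5
    (lt_of_le_of_lt (bf_al_neg hkj hjk (C.h0 _ _)) (by norm_num))
  have := (C.bad n).W1 hj h2 h3
  linarith

theorem T2 {n : ℕ} {k : B} (hk : k ∈ C.K n) : M k (C.i (n + 2)) = 2 := by
  by_contra h
  have hnot : C.i (n + 2) ∉ C.K n := fun h' => C.hnot (n + 1) (C.K_mono (by omega) h')
  exact C.no_triangle (C.hne n) (C.hne (n + 1)) (C.i_inj (by omega)) (C.adj n) (C.adj (n + 1))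
    (C.T1 hnot hk h)

theorem finrank_L (n : ℕ) : Module.finrank ℝ (C.L n) ≤ Module.finrank ℝ (C.L 0) := by
  induction n with
  | zero => exact le_rfl
  | succ n ih =>
    have : FiniteDimensional ℝ (C.L n) := (C.bad n).struct.2.1
    rw [C.L_succ]
    exact (Submodule.finrank_map_le _ _).trans ih

theorem T3 {n : ℕ} (hn : Module.finrank ℝ (C.L 0) < n + 1) {k : B} (hk : k ∈ C.K n)
    {v : B →₀ ℝ} (hv : v ∈ C.L (n + 2)) : bf M v (al k) = 0 := by
  by_contra hne
  have hdich : ∀ k ∈ C.K n, ∀ v ∈ C.L (n + 2), bf M v (al k) ≠ 0 → al k ∈ C.L (n + 2) := by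
    intro k hk v hv hne
    refine (C.bad (n + 2)).pres_al ?_ hv hne
    rw [M.symmetric]; exact C.T2 hk
  have hin : ∀ k ∈ C.K n, ∀ b ∈ C.K n, al k ∈ C.L (n + 2) → b ≠ k → M k b ≠ 2 → al b ∈ C.L (n + 2) := by
    intro k hk b hb hkL hbk hM
    refine hdich b hb _ hkL (ne_of_lt ?_)
    exact lt_of_le_of_lt (bf_al_neg hbk.symm hM (C.h0 _ _)) (by norm_num)
  have hA := C.conn {k | k ∈ C.K n ∧ al k ∈ C.L (n + 2)} (Set.subset_univ _)
    ⟨k, hk, hdich k hk v hv hne⟩ (by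
    rintro a ⟨haK, haL⟩ b - hba hM
    by_cases hbK : b ∈ C.K n
    · exact ⟨hbK, hin a haK b hbK haL hba hM⟩
    exfalso
    have hni := C.T1 hbK haK hM
    by_cases hb1 : b = C.i (n + 1)
    swap
    · have hbK1 : b ∉ C.K (n + 1) := by
        rw [C.K_succ]; rintro (h | h)
        · exact hb1 h
        · exact hbK h
      have hni1 := C.T1 hbK1 (C.K_mono (Nat.le_succ n) haK) hM
      exact C.no_triangle (x := C.i n) (y := C.i (n + 1)) (z := b) (C.hne n) (Ne.symm hb1)
        (by rintro h; exact hbK (h ▸ C.mem_K n)) (C.adj n) hni1 hni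
    · subst hb1
      have han : a = C.i n := by
        by_contra han
        rcases n with _ | n
        · -- n = 0
          have : Module.finrank ℝ (C.L 0) = 0 := by omega
          have hfd : FiniteDimensional ℝ (C.L 0) := (C.bad 0).struct.2.1
          have h1 := Submodule.finrank_eq_zero.1 this
          have h2 := (C.bad 0).al_mem
          change al _ ∈ C.L 0 at h2
          rw [h1] at h2
          exact al_ne_zero _ ((Submodule.mem_bot ℝ).1 h2)
        · have : a ∈ C.K n := by
            have h := haK
            rw [C.K_succ] at h
            exact h.resolve_left han
          exact hM (C.T2 this)
      subst han
      have hall : ∀ d ≤ n, al (C.i (n - d)) ∈ C.L (n + 2) := by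
        intro d
        induction d with
        | zero => intro _; exact haL
        | succ d ih =>
          intro hd
          have e : n - d = n - (d + 1) + 1 := by omega
          have h1 := ih (by omega)
          rw [e] at h1
          refine hin _ ?_ _ ?_ h1 (C.hne _) ?_
          · exact C.K_mono (by omega) (C.mem_K _)
          · exact C.K_mono (by omega) (C.mem_K _)
          · rw [M.symmetric]; exact C.adj _
      have hall' : ∀ m : Fin (n + 1), al (C.i m) ∈ C.L (n + 2) := by
        intro m
        have := hall (n - m) (by omega)
        have e : n - (n - (m : ℕ)) = m := by omega
        rwa [e] at this
      have hfd : FiniteDimensional ℝ (C.L (n + 2)) := (C.bad (n + 2)).struct.2.1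
      have hli : LinearIndependent ℝ (fun m : Fin (n + 1) => (⟨al (C.i m), hall' m⟩ : C.L (n + 2))) := by
        apply LinearIndependent.of_comp (C.L (n + 2)).subtype
        have h := (Finsupp.basisSingleOne (R := ℝ) (ι := B)).linearIndependent.comp
          (fun m : Fin (n + 1) => C.i m) (fun x y h => Fin.ext (C.i_injective h))
        convert h using 1
        funext m; simp [al]
      have := hli.fintype_card_le_finrank
      rw [Fintype.card_fin] at this
      have := C.finrank_L (n + 2)
      omega)
  have hfin : (C.K n).Finite := (C.bad n).struct.1
  have := C.inf
  have h1 : {k | k ∈ C.K n ∧ al k ∈ C.L (n + 2)}.Finite := hfin.subset (fun k hk => hk.1)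
  rw [hA] at h1
  exact Set.infinite_univ h1

end Chain

end CoxRefl

namespace CoxRefl

open CoxeterSystem

variable {B W : Type*} [Group W] {M : CoxeterMatrix B} {cs : CoxeterSystem M W}

theorem bf_VV {K : Set B} {v w : B →₀ ℝ} (h : ∀ k ∈ K, bf M v (al k) = 0) (hw : w ∈ VV K) :
    bf M v w = 0 := by
  have : VV K ≤ LinearMap.ker (bf M v) := by
    rw [VV_eq_span, Submodule.span_le]
    rintro _ ⟨k, hk, rfl⟩
    exact h k hk
  exact this hw

theorem comm_eig {q : W} {i : B} (h : q * cs.simple i = cs.simple i * q) :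
    ∃ e : ℝ, (e = 1 ∨ e = -1) ∧ rho cs q (al i) = e • al i := by
  have h1 := congrArg (fun w => rho cs w (al i)) h
  simp only [rho_mul, rho_simple_self, map_neg] at h1
  rw [rho_simple, sg_apply] at h1
  have h2 : rho cs q (al i) = bf M (al i) (rho cs q (al i)) • al i := by
    have h3 : (2 : ℝ) • rho cs q (al i) = (2 : ℝ) • (bf M (al i) (rho cs q (al i)) • al i) := by
      have e : (2 : ℝ) • rho cs q (al i) = rho cs q (al i) - (- rho cs q (al i)) := by module
      rw [e, h1]; module
    exact smul_right_injective _ (two_ne_zero) h3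
  refine ⟨_, ?_, h2⟩
  have h3 := bf_rho cs q (al i) (al i)
  rw [h2] at h3
  simp only [map_smul, LinearMap.smul_apply, smul_eq_mul, bf_al_self, mul_one] at h3
  exact mul_self_eq_one_iff.1 h3

namespace Chain

variable {R : W → Prop} (C : Chain cs R)

theorem cc_eq (n : ℕ) : cc M (C.i n) (C.i (n + 1)) = 1 / 2 := by
  rw [cc, C.M_eq n]
  push_cast
  exact Real.cos_pi_div_three

theorem bf_succ (n : ℕ) : bf M (C.a n) (C.a (n + 1)) = -(1 / 2) := by
  rw [a, a, bf_cc, C.cc_eq]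

theorem bf_far {m n : ℕ} (h : m + 2 ≤ n) : bf M (C.a m) (C.a n) = 0 := by
  obtain ⟨n, rfl⟩ : ∃ k, n = k + 2 := ⟨n - 2, by omega⟩
  exact bf_al_two (C.T2 (C.K_mono (by omega) (C.mem_K m)))

theorem mem_bf_far {m n : ℕ} (h : m + 2 ≤ n) {v : B →₀ ℝ} (hv : v ∈ C.L m) : bf M v (C.a n) = 0 := by
  obtain ⟨n, rfl⟩ : ∃ k, n = k + 2 := ⟨n - 2, by omega⟩
  rw [bf_symm]
  refine bf_VV (K := C.K m) (fun k hk => ?_) (le_VV_supp hv)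
  rw [bf_symm]
  exact bf_al_two (C.T2 (C.K_mono (by omega) hk))

theorem step_mem {n : ℕ} {v : B →₀ ℝ} (hv : v ∈ C.L n) (h : bf M v (C.a n) = 0) :
    v - (2 * bf M v (C.a (n + 1))) • (C.a n + C.a (n + 1)) ∈ C.L (n + 1) := by
  obtain ⟨x, h1, h2⟩ := C.hform n v h
  rw [C.cc_eq] at h2
  have hx : x = - (2 * bf M v (C.a (n + 1))) := by
    change _ = bf M v (C.a (n + 1)) at h2
    linarith
  have h3 : rho cs (C.u n) v ∈ C.L (n + 1) := by
    rw [C.L_succ]; exact Submodule.mem_map_of_mem hv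
  rw [h1, hx, neg_smul, ← sub_eq_add_neg] at h3
  exact h3

theorem exists_gamma : ∃ m, Module.finrank ℝ (C.L 0) < m ∧ ∃ g ∈ C.L m, bf M g (C.a m) = 0 ∧
    bf M g g = 1 ∧ ∀ v ∈ C.L m, v = bf M v (C.a m) • C.a m + bf M v g • g := by
  set n := Module.finrank ℝ (C.L 0) with hn
  refine ⟨n + 2, by omega, ?_⟩
  have hT : ∀ k ∈ C.K n, ∀ v ∈ C.L (n + 2), bf M v (al k) = 0 := fun k hk v hv =>
    C.T3 (by omega) hk hv
  have hinj : ∀ v ∈ C.L (n + 2), bf M v (C.a (n + 2)) = 0 → bf M v (C.a (n + 1)) = 0 → v = 0 := by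
    intro v hv h2 h1
    by_contra hne
    have h3 := C.pd v hne
    have : bf M v v = 0 := by
      refine bf_VV (K := C.K (n + 2)) (fun k hk => ?_) (le_VV_supp hv)
      rw [C.K_succ, C.K_succ] at hk
      rcases hk with rfl | rfl | hk
      · exact h2
      · exact h1
      · exact hT k hk v hv
    linarith
  obtain ⟨N, ⟨v0, hv0⟩, hN, -⟩ := (C.bad (n + 2)).exists_N
  obtain ⟨h1, -, h3, h4⟩ := hN v0 hv0
  have hpos := C.pd v0 h3
  have hs : (√(bf M v0 v0))⁻¹ * ((√(bf M v0 v0))⁻¹ * bf M v0 v0) = 1 := by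
    have := Real.mul_self_sqrt hpos.le
    have hp : 0 < √(bf M v0 v0) := Real.sqrt_pos.2 hpos
    field_simp
    nlinarith
  set s := (√(bf M v0 v0))⁻¹ with hsdef
  have hg : s • v0 ∈ C.L (n + 2) := Submodule.smul_mem _ _ h1
  have hga : bf M (s • v0) (C.a (n + 2)) = 0 := by
    rw [map_smul, LinearMap.smul_apply, h4, smul_zero]
  have hgg : bf M (s • v0) (s • v0) = 1 := by
    simpa only [map_smul, LinearMap.smul_apply, smul_eq_mul] using hs
  generalize s • v0 = g at hg hga hgg
  refine ⟨g, hg, hga, hgg, ?_⟩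
  have hy : bf M g (C.a (n + 1)) ≠ 0 := by
    intro h
    rw [hinj g hg hga h] at hgg
    simp at hgg
  intro v hv
  have haL : C.a (n + 2) ∈ C.L (n + 2) := (C.bad (n + 2)).al_mem
  set w := v - bf M v (C.a (n + 2)) • C.a (n + 2) with hw
  have hwL : w ∈ C.L (n + 2) := sub_mem hv (Submodule.smul_mem _ _ haL)
  have hwa : bf M w (C.a (n + 2)) = 0 := by
    simp [hw, bf_al_self]
  set c := bf M w (C.a (n + 1)) / bf M g (C.a (n + 1)) with hc
  have hz := hinj (w - c • g) (sub_mem hwL (Submodule.smul_mem _ _ hg))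
    (by simp only [map_sub, map_smul, LinearMap.sub_apply, LinearMap.smul_apply, smul_eq_mul]; rw [hwa, hga]; simp)
    (by
      simp only [map_sub, map_smul, LinearMap.sub_apply, LinearMap.smul_apply, smul_eq_mul]
      rw [hc]; field_simp; ring)
  have hwc : w = c • g := sub_eq_zero.1 hz
  have hvw : v = bf M v (C.a (n + 2)) • C.a (n + 2) + c • g := by
    rw [← hwc, hw]; module
  have hcv : bf M v g = c := by
    rw [hvw]
    simp only [map_add, map_smul, LinearMap.add_apply, LinearMap.smul_apply, smul_eq_mul, hgg]
    rw [bf_symm (C.a (n + 2)) g, hga]; ring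
  rw [hcv]; exact hvw

theorem contra {cs : CoxeterSystem M W} {R : W → Prop} (C : Chain cs R) : False := by
  obtain ⟨m, hm, g, hg, hga, hgg, hdec⟩ := C.exists_gamma
  -- action of elements of Q
  have hact : ∀ q ∈ C.Q m, ∃ e d : ℝ, (e = 1 ∨ e = -1) ∧ (d = 1 ∨ d = -1) ∧
      ∀ v, rho cs q v = v + ((e - 1) * bf M v (C.a m)) • C.a m + ((d - 1) * bf M v g) • g := by
    intro q hq
    have hcomm := (C.bad m).comm q hq
    obtain ⟨e, he, hqa⟩ := comm_eig hcomm
    have hee : e * e = 1 := by rcases he with rfl | rfl <;> norm_num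
    have hqe : ∀ v, bf M (rho cs q v) (C.a m) = e * bf M v (C.a m) := by
      intro v
      rw [← bf_rho cs q v (C.a m)]
      simp only [a, hqa, map_smul, smul_eq_mul]
      rw [← mul_assoc, hee, one_mul]
    have hqg : rho cs q g = bf M (rho cs q g) g • g := by
      have h := hdec _ ((C.bad m).pres hcomm hg)
      rw [hqe, hga, mul_zero, zero_smul, zero_add] at h
      exact h
    set d := bf M (rho cs q g) g with hd
    have hdd : d * d = 1 := by
      have h := bf_rho cs q g g
      rw [hqg] at h
      simpa only [map_smul, LinearMap.smul_apply, smul_eq_mul, hgg, mul_one] using h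
    have hqd : ∀ v, bf M (rho cs q v) g = d * bf M v g := by
      intro v
      rw [← bf_rho cs q v g, hqg, map_smul, smul_eq_mul, ← mul_assoc, hdd, one_mul]
    refine ⟨e, d, he, mul_self_eq_one_iff.1 hdd, fun v => ?_⟩
    have h := hdec _ (sub_mem_mv (cs := cs) hq v)
    rw [map_sub, LinearMap.sub_apply, LinearMap.sub_apply, hqe, hqd] at h
    rw [add_assoc, ← sub_eq_iff_eq_add', h]
    module
  have hq : ∃ q, R q ∧ ∀ v, rho cs q v = v - (2 * bf M g v) • g := by
    obtain ⟨a, ha, b, hb, hab, ha1, hb1, has, hbs, hRa, hRb⟩ := (C.bad m).two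
    obtain ⟨e, d, he, hd, hA⟩ := hact a ha
    obtain ⟨e', d', he', hd', hB⟩ := hact b hb
    have n1 : ∀ q (e d : ℝ), (∀ v, rho cs q v = v + ((e - 1) * bf M v (C.a m)) • C.a m + ((d - 1) * bf M v g) • g)
        → (e = 1 ∨ e = -1) → q ≠ 1 → q ≠ cs.simple (C.i m) → d ≠ 1 := by
      rintro q e d h (rfl | rfl) h1 h2 rfl
      · apply h1
        apply rho_faithful cs
        intro v
        rw [h, rho_one]; simp
      · apply h2
        apply rho_faithful cs
        intro v
        rw [h, rho_simple, sg_apply, bf_symm]; module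
    have hd1 := hd.resolve_left (n1 a e d hA he ha1 has)
    have hd1' := hd'.resolve_left (n1 b e' d' hB he' hb1 hbs)
    subst hd1 hd1'
    rcases he with rfl | rfl
    · refine ⟨a, hRa, fun v => ?_⟩
      rw [hA, bf_symm g v]; module
    rcases he' with rfl | rfl
    · refine ⟨b, hRb, fun v => ?_⟩
      rw [hB, bf_symm g v]; module
    exfalso
    apply hab
    apply rho_faithful cs
    intro v
    rw [hA, hB]
  obtain ⟨q, hR, hq⟩ := hq
  set y := bf M g (C.a (m + 1)) with hy
  have e01 := C.bf_succ m
  have e12 := C.bf_succ (m + 1)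
  have e23 := C.bf_succ (m + 2)
  have e02 := C.bf_far (show m + 2 ≤ m + 2 by omega)
  have e03 := C.bf_far (show m + 2 ≤ m + 3 by omega)
  have e13 := C.bf_far (show m + 1 + 2 ≤ m + 3 by omega)
  have g2 := C.mem_bf_far (show m + 2 ≤ m + 2 by omega) hg
  have g3 := C.mem_bf_far (show m + 2 ≤ m + 3 by omega) hg
  have s0 : bf M (C.a m) (C.a m) = 1 := bf_al_self _
  have s1 : bf M (C.a (m + 1)) (C.a (m + 1)) = 1 := bf_al_self _
  have s2 : bf M (C.a (m + 2)) (C.a (m + 2)) = 1 := bf_al_self _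
  have h1 := C.step_mem hg hga
  rw [← hy] at h1
  set γ1 := g - (2 * y) • (C.a m + C.a (m + 1)) with hγ1
  have b11 : bf M γ1 (C.a (m + 1)) = 0 := by
    simp only [hγ1, map_sub, map_add, map_smul, LinearMap.sub_apply, LinearMap.add_apply, LinearMap.smul_apply, smul_eq_mul]
    rw [← hy, e01, s1]; ring
  have b12 : bf M γ1 (C.a (m + 1 + 1)) = y := by
    simp only [hγ1, map_sub, map_add, map_smul, LinearMap.sub_apply, LinearMap.add_apply, LinearMap.smul_apply, smul_eq_mul]
    rw [e12, e02, g2]; ring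
  have b13 : bf M γ1 (C.a (m + 3)) = 0 := by
    simp only [hγ1, map_sub, map_add, map_smul, LinearMap.sub_apply, LinearMap.add_apply, LinearMap.smul_apply, smul_eq_mul]
    rw [e13, e03, g3]; ring
  have h2 := C.step_mem h1 b11
  rw [b12] at h2
  set γ2 := γ1 - (2 * y) • (C.a (m + 1) + C.a (m + 1 + 1)) with hγ2
  have b22 : bf M γ2 (C.a (m + 1 + 1)) = 0 := by
    simp only [hγ2, map_sub, map_add, map_smul, LinearMap.sub_apply, LinearMap.add_apply, LinearMap.smul_apply, smul_eq_mul]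
    rw [b12, e12, s2]; ring
  have b23 : bf M γ2 (C.a (m + 1 + 1 + 1)) = y := by
    simp only [hγ2, map_sub, map_add, map_smul, LinearMap.sub_apply, LinearMap.add_apply, LinearMap.smul_apply, smul_eq_mul]
    rw [b13, e13, e23]; ring
  have h3 := C.step_mem h2 b22
  rw [b23] at h3
  set γ3 := γ2 - (2 * y) • (C.a (m + 1 + 1) + C.a (m + 1 + 1 + 1)) with hγ3
  have c1 : bf M g γ1 = 1 - 2 * y * y := by
    simp only [hγ1, map_sub, map_add, map_smul, smul_eq_mul]
    rw [hgg, hga, ← hy]; ring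
  have c2 : bf M g γ2 = 1 - 4 * y * y := by
    simp only [hγ2, map_sub, map_add, map_smul, smul_eq_mul]
    rw [c1, g2, ← hy]; ring
  have c3 : bf M g γ3 = 1 - 4 * y * y := by
    simp only [hγ3, map_sub, map_add, map_smul, smul_eq_mul]
    rw [c2, g2, g3]; ring
  have hcomm : q * cs.simple (C.i (m + 3)) = cs.simple (C.i (m + 3)) * q := by
    apply comm_simple (e := 1) (Or.inl rfl)
    rw [hq]
    change _ - (2 * bf M g (C.a (m + 3))) • g = _
    rw [g3]; simp
  have h4 := sub_mem ((C.bad (m + 3)).pres hcomm h3) h3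
  rw [hq, c3] at h4
  have hyy : 4 * y * y = 1 := by
    by_contra hne
    have h5 : γ3 - (2 * (1 - 4 * y * y)) • g - γ3 = (- (2 * (1 - 4 * y * y))) • g := by module
    rw [h5] at h4
    have hgL : g ∈ C.L (m + 3) := (Submodule.smul_mem_iff _ (by
      intro h; apply hne; linarith)).1 h4
    have : bf M g g = 0 := bf_VV (K := C.K m) (fun k hk =>
      C.T3 (n := m + 1) (by omega) (C.K_mono (by omega) hk) hgL) (le_VV_supp hg)
    linarith
  have hconj : (cs.simple (C.i (m + 1)) * q) * cs.simple (C.i (m + 1)) * (cs.simple (C.i (m + 1)) * q)⁻¹ = q := by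
    refine conj_simple (e := -(2 * y)) (b := g) ?_ hq ?_
    · have : (2 * y) * (2 * y) = 1 := by linarith
      rcases mul_self_eq_one_iff.1 this with h | h
      · right; rw [h]
      · left; rw [h]; norm_num
    · rw [rho_mul, hq]
      change rho cs _ (C.a (m + 1) - (2 * bf M g (C.a (m + 1))) • g) = _
      rw [← hy, rho_simple, sg_apply, map_sub, map_smul]
      change _ - _ - (2 * (bf M (C.a (m + 1)) (C.a (m + 1)) - _ • bf M (C.a (m + 1)) g)) • C.a (m + 1) = _
      rw [s1, bf_symm (C.a (m + 1)) g, ← hy]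
      have : (2 * (1 - (2 * y) • y) : ℝ) = 1 := by rw [smul_eq_mul]; linarith
      rw [this]; module
  apply (C.bad (m + 1)).nr
  have := (C.bad (m + 1)).conj q (cs.simple (C.i (m + 1)) * q)⁻¹ hR
  generalize cs.simple (C.i (m + 1)) * q = x at hconj this
  have e : x⁻¹ * q * x⁻¹⁻¹ = cs.simple (C.i (m + 1)) := by
    conv_lhs => rw [← hconj]
    group
  rwa [e] at this

end Chain

end CoxRefl

namespace CoxRefl

open CoxeterSystem

variable {B W : Type*} [Group W] {M : CoxeterMatrix B} {cs : CoxeterSystem M W}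

theorem no_bad (hirr : (cg M).Connected) (h0 : ∀ b b' : B, M b b' ≠ 0) (hinf : Infinite W)
    {R : W → Prop} {i : B} {Q : Subgroup W} (hb : Bad cs R i Q) : False := by
  by_cases h : ∃ J0 : Set B, J0.Finite ∧ ¬ (par cs J0 : Set W).Finite
  · obtain ⟨J0, hJ0, hP⟩ := h
    obtain ⟨J, hJ, hsub, hconn⟩ := exists_conn hirr (hJ0.union hb.struct.1)
    refine caseI hb h0 hJ hconn (fun hfin => hP ?_) (Set.subset_union_right.trans hsub)
    exact hfin.subset (par_mono (cs := cs) (Set.subset_union_left.trans hsub))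
  · push Not at h
    have pd : ∀ v : B →₀ ℝ, v ≠ 0 → 0 < bf M v v := by
      intro v hv
      refine posdef (cs := cs) (K := (v.support : Set B)) v.support.finite_toSet
        (h _ v.support.finite_toSet) ?_ hv
      rw [mem_VV]
      intro k hk
      simpa using hk
    have hB : Infinite B := by
      rw [← not_finite_iff_infinite]
      intro hfin
      have h1 := h Set.univ Set.finite_univ
      have h2 : (par cs Set.univ : Set W) = Set.univ := by
        rw [Set.eq_univ_iff_forall]
        intro w
        apply mem_par_of_sub
        intro v
        rw [mem_VV]; simp
      rw [h2] at h1
      exact Set.infinite_univ h1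
    obtain ⟨C⟩ := exists_chain hb h0 (connOn_univ hirr) pd hB
    exact C.contra

theorem isConj_of_odd {k l : B} (h : Odd (M k l)) : IsConj (cs.simple k) (cs.simple l) := by
  obtain ⟨p, hp⟩ := h
  have h1 := cs.simple_mul_simple_pow k l
  rw [hp] at h1
  set c := cs.simple k * cs.simple l with hc
  have hk : cs.simple k * cs.simple k = 1 := cs.simple_mul_simple_self k
  have hl : (cs.simple l)⁻¹ = cs.simple l := cs.inv_simple l
  have hk' : (cs.simple k)⁻¹ = cs.simple k := cs.inv_simple k
  have hs : SemiconjBy (cs.simple k) c⁻¹ c := by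
    rw [SemiconjBy, hc, mul_inv_rev, hl, hk', mul_assoc]
  have hs' := hs.pow_right p
  rw [SemiconjBy, inv_pow] at hs'
  rw [isConj_iff]
  refine ⟨c ^ p, ?_⟩
  rw [mul_assoc, hs', ← mul_assoc]
  have h2 : c ^ p * c ^ p = c⁻¹ := by
    rw [eq_inv_iff_mul_eq_one, ← h1, ← pow_add, ← pow_succ]
    congr 1; ring
  rw [h2, hc, mul_inv_rev, hl, hk', mul_assoc, hk, mul_one]

open Classical in
theorem exists_eps (j : B) : ∃ e : W →* ℤˣ, ∀ k, e (cs.simple k) =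
    if IsConj (cs.simple k) (cs.simple j) then -1 else 1 := by
  have hl : M.IsLiftable (fun k => if IsConj (cs.simple k) (cs.simple j) then (-1 : ℤˣ) else 1) := by
    intro k l
    rcases Nat.even_or_odd (M k l) with h | h
    · obtain ⟨p, hp⟩ := h
      rw [hp, ← two_mul, pow_mul]
      have : ∀ x : ℤˣ, x ^ 2 = 1 := fun x => Int.units_sq x
      rw [this, one_pow]
    · have h1 := isConj_of_odd (cs := cs) h
      have : IsConj (cs.simple k) (cs.simple j) ↔ IsConj (cs.simple l) (cs.simple j) :=
        ⟨fun h => h1.symm.trans h, fun h => h1.trans h⟩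
      simp only [this]
      rw [Int.units_mul_self, one_pow]
  exact ⟨cs.lift ⟨_, hl⟩, fun k => cs.lift_apply_simple hl k⟩

theorem main_aux {B W : Type*} [Group W] {M : CoxeterMatrix B} (cs : CoxeterSystem M W)
    {B' W' : Type*} [Group W'] {M' : CoxeterMatrix B'} (cs' : CoxeterSystem M' W')
    (f : W ≃* W') (hs : ∀ i, cs'.IsReflection (f (cs.simple i))) :
    ⇑f '' {w | cs.IsReflection w} = {w' | cs'.IsReflection w'} := by
  classical
  apply Set.Subset.antisymm
  · rintro _ ⟨_, ⟨w, i, rfl⟩, rfl⟩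
    simp only [Set.mem_ofPred_eq, map_mul, map_inv]
    exact (hs i).conj (f w)
  · rintro _ ⟨w, j, rfl⟩
    obtain ⟨e, he⟩ := exists_eps (cs := cs') j
    have hex : ∃ i, e (f (cs.simple i)) ≠ 1 := by
      by_contra hcon
      push Not at hcon
      have h1 : e.comp f.toMonoidHom = 1 := by
        apply cs.ext_simple
        intro i
        simpa using hcon i
      have h2 := DFunLike.congr_fun h1 (f.symm (cs'.simple j))
      simp [he] at h2
      exact h2 1 (by simp)
    obtain ⟨i, hi⟩ := hex
    obtain ⟨g, k, hk⟩ := hs i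
    have hkj : IsConj (cs'.simple k) (cs'.simple j) := by
      by_contra hcon
      apply hi
      rw [hk, map_mul, map_mul, he, if_neg hcon, mul_one, ← map_mul, mul_inv_cancel, map_one]
    obtain ⟨c, hc⟩ := isConj_iff.1 hkj
    refine ⟨f.symm (w * c * g⁻¹) * cs.simple i * (f.symm (w * c * g⁻¹))⁻¹, ⟨_, i, rfl⟩, ?_⟩
    rw [map_mul, map_mul, map_inv, MulEquiv.apply_symm_apply, hk, ← hc]
    group

end CoxRefl

theorem stmt_14 {B W : Type*} [Group W] {M : CoxeterMatrix B} (cs : CoxeterSystem M W)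
    (hirr : (SimpleGraph.fromRel fun b b' : B => M b b' ≠ 2).Connected)
    (h2sph : ∀ b b' : B, M b b' ≠ 0)
    (hinf : Infinite W)
    {B' W' : Type*} [Group W'] {M' : CoxeterMatrix B'} (cs' : CoxeterSystem M' W')
    (f : W ≃* W') :
    ⇑f '' {w | cs.IsReflection w} = {w' | cs'.IsReflection w'} := by
  apply CoxRefl.main_aux
  intro i
  by_contra h
  obtain ⟨Q, hQ⟩ := CoxRefl.exists_bad (cs := cs) (cs' := cs') f i h
  exact CoxRefl.no_bad hirr h2sph hinf hQ
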